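/- arXiv:2202.09575 — 7 statements merged into one kernel-verified Lean document; each statement's English description precedes it below -/
import Mathlib

section
/- For every n ≥ 0 and every k ∈ {1,2}, the following four matrix identities hold: (i) J_n^{(0,0)} · L_{2n,k} = J_n^{(2−k,k−1)}; (ii) J_n^{(1,1)} · L_{2n+2,k} = L_{n,k} · J_{n+1}^{(k−1,2−k)}; (iii) J_n^{(k−1,2−k)} · L_{2n+1,k} = J_n^{(1,1)}; (iv) J_n^{(2−k,k−1)} · L_{2n+1,k} = L_{n,k} · J_{n+1}^{(0,0)}. -/
noncomputable section

/-- `Lmat n k` is the `(n+1) × (n+2)` matrix `L_{n,k}` (for `k = 1, 2`):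
`(L_{n,1})_{h,m} = 1` iff `m = h`, `(L_{n,2})_{h,m} = 1` iff `m = h + 1`. -/
def Lmat (n k : ℕ) : Matrix (Fin (n + 1)) (Fin (n + 2)) ℝ :=
  Matrix.of fun h m => if (m : ℕ) = (h : ℕ) + (k - 1) then 1 else 0

/-- `Jmat r c j` is the `r × c` matrix whose `(h, m)` entry is `1` iff `m = 2h + j`;
`J_n^{(i,j)}` is `Jmat (n+1) (2*n+1+i+j) j`. -/
def Jmat (r c j : ℕ) : Matrix (Fin r) (Fin c) ℝ :=
  Matrix.of fun h m => if (m : ℕ) = 2 * (h : ℕ) + j then 1 else 0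

theorem Jmat_mul_apply {r c d : ℕ} (j : ℕ) (M : Matrix (Fin c) (Fin d) ℝ) (h : Fin r) (m : Fin d)
    (hc : 2 * (h : ℕ) + j < c) : (Jmat r c j * M) h m = M ⟨2 * (h : ℕ) + j, hc⟩ m := by
  rw [Matrix.mul_apply, Finset.sum_eq_single ⟨2 * (h : ℕ) + j, hc⟩]
  · simp [Jmat]
  · intro b _ hb
    simp [Jmat, show (b : ℕ) ≠ 2 * (h : ℕ) + j from fun e => hb (Fin.ext e)]
  · simp

theorem Lmat_mul_apply {n d : ℕ} (k : ℕ) (M : Matrix (Fin (n + 2)) (Fin d) ℝ) (h : Fin (n + 1))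
    (m : Fin d) (hc : (h : ℕ) + (k - 1) < n + 2) :
    (Lmat n k * M) h m = M ⟨(h : ℕ) + (k - 1), hc⟩ m := by
  rw [Matrix.mul_apply, Finset.sum_eq_single ⟨(h : ℕ) + (k - 1), hc⟩]
  · simp [Lmat]
  · intro b _ hb
    simp [Lmat, show (b : ℕ) ≠ (h : ℕ) + (k - 1) from fun e => hb (Fin.ext e)]
  · simp

/-- For every `n ≥ 0` and `k ∈ {1,2}`:
(i)   `J_n^{(0,0)} L_{2n,k} = J_n^{(2-k,k-1)}`;
(ii)  `J_n^{(1,1)} L_{2n+2,k} = L_{n,k} J_{n+1}^{(k-1,2-k)}`;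
(iii) `J_n^{(k-1,2-k)} L_{2n+1,k} = J_n^{(1,1)}`;
(iv)  `J_n^{(2-k,k-1)} L_{2n+1,k} = L_{n,k} J_{n+1}^{(0,0)}`. -/
theorem stmt0 (n k : ℕ) (hk : k = 1 ∨ k = 2) :
    Jmat (n + 1) (2 * n + 1) 0 * Lmat (2 * n) k = Jmat (n + 1) (2 * n + 2) (k - 1) ∧
    Jmat (n + 1) (2 * n + 3) 1 * Lmat (2 * n + 2) k
      = Lmat n k * Jmat (n + 2) (2 * n + 4) (2 - k) ∧
    Jmat (n + 1) (2 * n + 2) (2 - k) * Lmat (2 * n + 1) k = Jmat (n + 1) (2 * n + 3) 1 ∧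
    Jmat (n + 1) (2 * n + 2) (k - 1) * Lmat (2 * n + 1) k
      = Lmat n k * Jmat (n + 2) (2 * n + 3) 0 := by
  refine ⟨?_, ?_, ?_, ?_⟩ <;> ext h m
  · rw [Jmat_mul_apply _ _ _ _ (by omega)]
    simp only [Lmat, Jmat, Matrix.of_apply]
    congr 1
  · rw [Jmat_mul_apply _ _ _ _ (by omega), Lmat_mul_apply _ _ _ _ (by omega)]
    simp only [Lmat, Jmat, Matrix.of_apply]
    congr 2
    omega
  · rw [Jmat_mul_apply _ _ _ _ (by omega)]
    simp only [Lmat, Jmat, Matrix.of_apply]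
    congr 2
    omega
  · rw [Jmat_mul_apply _ _ _ _ (by omega), Lmat_mul_apply _ _ _ _ (by omega)]
    simp only [Lmat, Jmat, Matrix.of_apply]
    congr 2
    omega
end
end

section
/- Let W be a weight function on a measurable set Ω ⊆ ℝ², let λ(x,y) = a·x + b·y with |a| + |b| > 0, and suppose W*(x,y) = λ(x,y)·W(x,y) is again a weight function on Ω. Let {Pₙ} and {Pₙ*} be the MOPS of W and of W* respectively, and assume the Gram matrices 𝐏ₙ = ∫_Ω Pₙ Pₙᵀ W dx dy and 𝐏ₙ* = ∫_Ω Pₙ* (Pₙ*)ᵀ W* dx dy are invertible for all n. Then for all n ≥ 1: Pₙ = Pₙ* + Mₙ P*_{n−1} with Mₙ = 𝐏ₙ (a·L_{n−1,1}ᵀ + b·L_{n−1,2}ᵀ)(𝐏*_{n−1})⁻¹, and λ(x,y)·Pₙ* = (a·L_{n,1} + b·L_{n,2}) P_{n+1} + Nₙ Pₙ with Nₙ = 𝐏ₙ* 𝐏ₙ⁻¹. -/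
noncomputable section

open MeasureTheory MvPolynomial Matrix

/-- Evaluation of a bivariate polynomial at a point of `ℝ × ℝ`. -/
def ev (p : ℝ × ℝ) (f : MvPolynomial (Fin 2) ℝ) : ℝ := eval ![p.1, p.2] f

/-- `W` is a weight function on the measurable set `Ω ⊆ ℝ²`: nonnegative and measurable,
positive on a set of positive Lebesgue measure, with all moments finite. -/
def IsWeight (Ω : Set (ℝ × ℝ)) (W : ℝ × ℝ → ℝ) : Prop :=
  MeasurableSet Ω ∧ Measurable W ∧ (∀ p ∈ Ω, 0 ≤ W p) ∧
    0 < volume {p | p ∈ Ω ∧ 0 < W p} ∧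
    ∀ h k : ℕ, IntegrableOn (fun p : ℝ × ℝ => p.1 ^ h * p.2 ^ k * W p) Ω

/-- `W` is an `xy`-symmetric weight on `Ω`: `Ω` is invariant under `(x,y) ↦ (-x,y)` and
`(x,y) ↦ (x,-y)`, and `W(-x,y) = W(x,y) = W(x,-y)` on `Ω`. -/
def XYSymmetric (Ω : Set (ℝ × ℝ)) (W : ℝ × ℝ → ℝ) : Prop :=
  (∀ p : ℝ × ℝ, p ∈ Ω → (-p.1, p.2) ∈ Ω ∧ (p.1, -p.2) ∈ Ω) ∧
    ∀ p ∈ Ω, W (-p.1, p.2) = W p ∧ W (p.1, -p.2) = W p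

/-- `f` is monic of the form `x^(n-j) y^j + (terms of total degree < n)`. -/
def MonicLead (n j : ℕ) (f : MvPolynomial (Fin 2) ℝ) : Prop :=
  f = X 0 ^ (n - j) * X 1 ^ j ∨ (f - X 0 ^ (n - j) * X 1 ^ j).totalDegree < n

/-- `P` is the monic orthogonal polynomial system (MOPS) of the weight `W` on `Ω`:
each `P n j` is monic with leading term `x^(n-j) y^j`, and vectors of different degrees
are mutually orthogonal. -/
def IsMOPS (Ω : Set (ℝ × ℝ)) (W : ℝ × ℝ → ℝ)
    (P : (n : ℕ) → Fin (n + 1) → MvPolynomial (Fin 2) ℝ) : Prop :=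
  (∀ (n : ℕ) (j : Fin (n + 1)), MonicLead n (j : ℕ) (P n j)) ∧
    ∀ m n : ℕ, m ≠ n → ∀ (i : Fin (m + 1)) (j : Fin (n + 1)),
      ∫ p in Ω, ev p (P m i) * ev p (P n j) * W p = 0

/-- The image domain `Ω* = {(u,v) : u ≥ 0, v ≥ 0, (√u, √v) ∈ Ω}`. -/
def Ωstar (Ω : Set (ℝ × ℝ)) : Set (ℝ × ℝ) :=
  {q | 0 ≤ q.1 ∧ 0 ≤ q.2 ∧ (Real.sqrt q.1, Real.sqrt q.2) ∈ Ω}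

/-- The weight `W^(0,0)(u,v) = (1/4) (uv)^(-1/2) W(√u, √v)` on `Ω*`. -/
def W00 (W : ℝ × ℝ → ℝ) : ℝ × ℝ → ℝ :=
  fun q => (1 / 4) * W (Real.sqrt q.1, Real.sqrt q.2) / Real.sqrt (q.1 * q.2)

/-- The polynomials all of whose monomials have total degree `< n`. -/
def degLT (n : ℕ) : Submodule ℝ (MvPolynomial (Fin 2) ℝ) where
  carrier := {f | ∀ d : Fin 2 →₀ ℕ, n ≤ d 0 + d 1 → coeff d f = 0}
  add_mem' hf hg d hd := by simp [hf d hd, hg d hd]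
  zero_mem' d _ := by simp
  smul_mem' c f hf d hd := by simp [hf d hd]

lemma mem_degLT {n : ℕ} {f : MvPolynomial (Fin 2) ℝ} :
    f ∈ degLT n ↔ ∀ d : Fin 2 →₀ ℕ, n ≤ d 0 + d 1 → coeff d f = 0 := Iff.rfl

lemma degLT_mono {m n : ℕ} (h : m ≤ n) : degLT m ≤ degLT n :=
  fun _ hf d hd => hf d (h.trans hd)

lemma degLT_zero {f : MvPolynomial (Fin 2) ℝ} (hf : f ∈ degLT 0) : f = 0 := by
  ext d
  simpa using hf d (Nat.zero_le _)

lemma C_mul_mem_degLT {n : ℕ} {f : MvPolynomial (Fin 2) ℝ} (c : ℝ) (hf : f ∈ degLT n) :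
    C c * f ∈ degLT n := by
  rw [C_mul']
  exact (degLT n).smul_mem c hf

lemma sum_C_mul_mem_degLT {n : ℕ} {ι : Type*} [Fintype ι] (c : ι → ℝ)
    {f : ι → MvPolynomial (Fin 2) ℝ} (hf : ∀ i, f i ∈ degLT n) :
    ∑ i, C (c i) * f i ∈ degLT n :=
  (degLT n).sum_mem fun i _ => C_mul_mem_degLT (c i) (hf i)

lemma X_mul_mem_degLT {n : ℕ} {f : MvPolynomial (Fin 2) ℝ} (i : Fin 2) (hf : f ∈ degLT n) :
    X i * f ∈ degLT (n + 1) := by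
  intro d hd
  rw [coeff_X_mul']
  split_ifs with h
  · apply hf
    rw [Finsupp.mem_support_iff] at h
    fin_cases i <;> simp at h ⊢ <;> omega
  · rfl

lemma linear_mul_mem_degLT {n : ℕ} {f : MvPolynomial (Fin 2) ℝ} (a b : ℝ) (hf : f ∈ degLT n) :
    (C a * X 0 + C b * X 1) * f ∈ degLT (n + 1) := by
  rw [add_mul, mul_assoc, mul_assoc]
  exact (degLT _).add_mem (C_mul_mem_degLT a (X_mul_mem_degLT 0 hf))
    (C_mul_mem_degLT b (X_mul_mem_degLT 1 hf))

lemma coeff_X_pow_mul_X_pow (k l : ℕ) (d : Fin 2 →₀ ℕ) :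
    coeff d (X 0 ^ k * X 1 ^ l : MvPolynomial (Fin 2) ℝ) =
      if k = d 0 ∧ l = d 1 then 1 else 0 := by
  rw [X_pow_eq_monomial, X_pow_eq_monomial, monomial_mul, coeff_monomial, one_mul]
  congr 1
  simp [Finsupp.ext_iff, Fin.forall_fin_two]

lemma MonicLead.sub_mem_degLT {n j : ℕ} {f : MvPolynomial (Fin 2) ℝ} (hf : MonicLead n j f) :
    f - X 0 ^ (n - j) * X 1 ^ j ∈ degLT n := by
  rcases hf with rfl | hf
  · simp
  · intro d hd
    apply coeff_eq_zero_of_totalDegree_lt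
    refine hf.trans_le (hd.trans_eq ?_)
    rw [← Finset.sum_subset (Finset.subset_univ d.support)
      (fun i _ hi => by simpa using hi) |>.symm]
    simp [Fin.sum_univ_two]

lemma exists_sub_sum_X_pow_mem_degLT {n : ℕ} {f : MvPolynomial (Fin 2) ℝ}
    (hf : f ∈ degLT (n + 1)) :
    ∃ c : Fin (n + 1) → ℝ,
      f - ∑ j, C (c j) * (X 0 ^ (n - (j : ℕ)) * X 1 ^ (j : ℕ)) ∈ degLT n := by
  refine ⟨fun j => coeff (Finsupp.single 0 (n - (j : ℕ)) + Finsupp.single 1 (j : ℕ)) f,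
    fun d hd => ?_⟩
  simp only [coeff_sub, coeff_sum, coeff_C_mul, coeff_X_pow_mul_X_pow]
  rcases hd.lt_or_eq with h | h
  · rw [hf d h, Finset.sum_eq_zero, sub_zero]
    intro j _
    rw [if_neg (by omega), mul_zero]
  · rw [Finset.sum_eq_single ⟨d 1, by omega⟩]
    · rw [if_pos (by simp; omega), mul_one, sub_eq_zero]
      congr 1
      ext i
      fin_cases i <;> simp [h]
    · intro j _ hj
      rw [if_neg (fun h' => hj (Fin.ext h'.2)), mul_zero]
    · simp

section MonicSystem

variable {P : (n : ℕ) → Fin (n + 1) → MvPolynomial (Fin 2) ℝ}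

lemma monic_mem_degLT (hP : ∀ n (j : Fin (n + 1)), MonicLead n (j : ℕ) (P n j)) (n : ℕ)
    (j : Fin (n + 1)) : P n j ∈ degLT (n + 1) := by
  rw [← sub_add_cancel (P n j) (X 0 ^ (n - (j : ℕ)) * X 1 ^ (j : ℕ))]
  refine (degLT _).add_mem (degLT_mono n.le_succ (hP n j).sub_mem_degLT) fun d hd => ?_
  rw [coeff_X_pow_mul_X_pow, if_neg (by omega)]

lemma exists_sub_sum_monic_mem_degLT (hP : ∀ n (j : Fin (n + 1)), MonicLead n (j : ℕ) (P n j))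
    {n : ℕ} {f : MvPolynomial (Fin 2) ℝ} (hf : f ∈ degLT (n + 1)) :
    ∃ c : Fin (n + 1) → ℝ, f - ∑ j, C (c j) * P n j ∈ degLT n := by
  obtain ⟨c, hc⟩ := exists_sub_sum_X_pow_mem_degLT hf
  refine ⟨c, ?_⟩
  have := (degLT n).sub_mem hc (sum_C_mul_mem_degLT c fun j => (hP n j).sub_mem_degLT)
  simpa only [mul_sub, Finset.sum_sub_distrib, sub_sub_sub_cancel_right,
    sub_sub, add_sub_cancel] using this

/-- Modulo lower degrees, multiplication by `a x + b y` acts on a monic system through the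
matrices `Lmat`. -/
lemma linear_mul_sub_sum_mem_degLT {Q : (n : ℕ) → Fin (n + 1) → MvPolynomial (Fin 2) ℝ}
    (hP : ∀ n (j : Fin (n + 1)), MonicLead n (j : ℕ) (P n j))
    (hQ : ∀ n (j : Fin (n + 1)), MonicLead n (j : ℕ) (Q n j)) (a b : ℝ) (n : ℕ)
    (i : Fin (n + 1)) :
    (C a * X 0 + C b * X 1) * Q n i -
      ∑ j, C ((a • Lmat n 1 + b • Lmat n 2) i j) * P (n + 1) j ∈ degLT (n + 1) := by
  have h1 : ∑ j, C ((a • Lmat n 1 + b • Lmat n 2) i j) * P (n + 1) j =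
      C a * P (n + 1) i.castSucc + C b * P (n + 1) i.succ := by
    simp only [Matrix.add_apply, Matrix.smul_apply, Lmat, Matrix.of_apply, smul_eq_mul, map_add,
      add_mul, Finset.sum_add_distrib]
    congr 1
    · rw [Finset.sum_eq_single i.castSucc _ (by simp)]
      · simp
      · intro j _ hj
        rw [if_neg (fun h => hj (Fin.ext (by simpa using h)))]
        simp
    · rw [Finset.sum_eq_single i.succ _ (by simp)]
      · simp
      · intro j _ hj
        rw [if_neg (fun h => hj (Fin.ext (by simpa using h)))]
        simp
  rw [h1]
  have h2 := linear_mul_mem_degLT a b (hQ n i).sub_mem_degLT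
  have h3 := C_mul_mem_degLT a (hP (n + 1) i.castSucc).sub_mem_degLT
  have h4 := C_mul_mem_degLT b (hP (n + 1) i.succ).sub_mem_degLT
  convert (degLT (n + 1)).sub_mem ((degLT (n + 1)).sub_mem h2 h3) h4 using 1
  have e1 : n + 1 - (i.castSucc : ℕ) = (n - i) + 1 := by simp; omega
  have e2 : n + 1 - (i.succ : ℕ) = n - i := by simp
  rw [e1, e2]
  simp only [Fin.val_castSucc, Fin.val_succ, pow_succ]
  ring

end MonicSystem

section Functional

variable {L : MvPolynomial (Fin 2) ℝ →ₗ[ℝ] ℝ}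
  {P : (n : ℕ) → Fin (n + 1) → MvPolynomial (Fin 2) ℝ}

lemma map_C_mul (L : MvPolynomial (Fin 2) ℝ →ₗ[ℝ] ℝ) (c : ℝ) (f : MvPolynomial (Fin 2) ℝ) :
    L (C c * f) = c * L f := by
  rw [C_mul', map_smul, smul_eq_mul]

lemma map_sum_C_mul_mul (L : MvPolynomial (Fin 2) ℝ →ₗ[ℝ] ℝ) {ι : Type*} [Fintype ι] (c : ι → ℝ)
    (f : ι → MvPolynomial (Fin 2) ℝ) (g : MvPolynomial (Fin 2) ℝ) :
    L ((∑ i, C (c i) * f i) * g) = ∑ i, c i * L (f i * g) := by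
  simp only [Finset.sum_mul, map_sum, mul_assoc, map_C_mul]

variable (hP : ∀ n (j : Fin (n + 1)), MonicLead n (j : ℕ) (P n j))
  (hL : ∀ m n : ℕ, m ≠ n → ∀ (i : Fin (m + 1)) (j : Fin (n + 1)), L (P m i * P n j) = 0)

include hP hL

lemma map_mul_eq_zero_of_mem_degLT {m n : ℕ} (hmn : m ≤ n) {f : MvPolynomial (Fin 2) ℝ}
    (hf : f ∈ degLT m) (j : Fin (n + 1)) : L (f * P n j) = 0 := by
  induction m generalizing f with
  | zero => simp [degLT_zero hf]
  | succ m ih =>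
    obtain ⟨c, hc⟩ := exists_sub_sum_monic_mem_degLT hP hf
    have h := ih (by omega) hc
    rw [sub_mul, map_sub, map_sum_C_mul_mul] at h
    simpa [hL m n (by omega)] using h

lemma eq_zero_of_forall_map_mul_eq_zero
    (hG : ∀ n, IsUnit (Matrix.of fun i j : Fin (n + 1) => L (P n i * P n j)).det)
    {n : ℕ} {f : MvPolynomial (Fin 2) ℝ} (hf : f ∈ degLT n)
    (h : ∀ m < n, ∀ j : Fin (m + 1), L (f * P m j) = 0) : f = 0 := by
  induction n with
  | zero => exact degLT_zero hf
  | succ n ih =>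
    obtain ⟨c, hc⟩ := exists_sub_sum_monic_mem_degLT hP hf
    have hc0 : c = 0 := by
      apply Matrix.eq_zero_of_vecMul_eq_zero (hG n).ne_zero
      ext k
      have h' := map_mul_eq_zero_of_mem_degLT hP hL le_rfl hc k
      rw [sub_mul, map_sub, map_sum_C_mul_mul, h n n.lt_succ_self, zero_sub, neg_eq_zero] at h'
      simpa [Matrix.vecMul, dotProduct] using h'
    refine ih (by simpa [hc0] using hc) fun m hm => h m (by omega)

/-- A polynomial of degree at most `n` orthogonal to all lower degrees is the expected combination
of the `P n j`. -/
lemma eq_sum_of_forall_map_mul_eq_zero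
    (hG : ∀ n, IsUnit (Matrix.of fun i j : Fin (n + 1) => L (P n i * P n j)).det)
    {n : ℕ} {f : MvPolynomial (Fin 2) ℝ} (hf : f ∈ degLT (n + 1))
    (h : ∀ m < n, ∀ j : Fin (m + 1), L (f * P m j) = 0) :
    f = ∑ j, C (((fun k => L (f * P n k)) ᵥ*
      (Matrix.of fun i j : Fin (n + 1) => L (P n i * P n j))⁻¹) j) * P n j := by
  set G := Matrix.of fun i j : Fin (n + 1) => L (P n i * P n j) with hGdef
  set v := fun k => L (f * P n k) with hv
  rw [← sub_eq_zero]
  refine eq_zero_of_forall_map_mul_eq_zero hP hL hG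
    ((degLT _).sub_mem hf (sum_C_mul_mem_degLT _ (monic_mem_degLT hP n))) fun m hm k => ?_
  rw [sub_mul, map_sub, map_sum_C_mul_mul]
  rcases (Nat.lt_succ_iff.mp hm).lt_or_eq with hm | rfl
  · simp [h m hm, hL n m hm.ne']
  · have : (v ᵥ* G⁻¹) ᵥ* G = v := by
      rw [Matrix.vecMul_vecMul, Matrix.nonsing_inv_mul _ (hG m), Matrix.vecMul_one]
    rw [sub_eq_zero]
    exact (congrFun this k).symm

end Functional

lemma integrableOn_ev_mul {Ω : Set (ℝ × ℝ)} {W : ℝ × ℝ → ℝ} (hW : IsWeight Ω W)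
    (f : MvPolynomial (Fin 2) ℝ) : IntegrableOn (fun p => ev p f * W p) Ω := by
  induction f using MvPolynomial.induction_on' with
  | monomial u c =>
    refine ((hW.2.2.2.2 (u 0) (u 1)).const_mul c).congr (ae_of_all _ fun p => ?_)
    simp [ev, eval_monomial, Finsupp.prod_fintype, Fin.prod_univ_two, mul_assoc]
  | add f g hf hg =>
    refine (hf.add hg).congr (ae_of_all _ fun p => ?_)
    simp [ev, add_mul]

/-- The moment functional `f ↦ ∫_Ω f W` of a weight. -/
def moment {Ω : Set (ℝ × ℝ)} {W : ℝ × ℝ → ℝ} (hW : IsWeight Ω W) :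
    MvPolynomial (Fin 2) ℝ →ₗ[ℝ] ℝ where
  toFun f := ∫ p in Ω, ev p f * W p
  map_add' f g := by
    rw [← integral_add (integrableOn_ev_mul hW f) (integrableOn_ev_mul hW g)]
    simp [ev, add_mul]
  map_smul' c f := by
    rw [RingHom.id_apply, smul_eq_mul, ← integral_const_mul]
    simp [ev, smul_eval, mul_assoc]

lemma moment_mul {Ω : Set (ℝ × ℝ)} {W : ℝ × ℝ → ℝ} (hW : IsWeight Ω W)
    (f g : MvPolynomial (Fin 2) ℝ) :
    moment hW (f * g) = ∫ p in Ω, ev p f * ev p g * W p := by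
  simp [moment, ev]

lemma moment_linear_mul {Ω : Set (ℝ × ℝ)} {W : ℝ × ℝ → ℝ} {a b : ℝ} (hW : IsWeight Ω W)
    (hWs : IsWeight Ω (fun p => (a * p.1 + b * p.2) * W p)) (f : MvPolynomial (Fin 2) ℝ) :
    moment hW ((C a * X 0 + C b * X 1) * f) = moment hWs f := by
  simp only [moment, LinearMap.coe_mk, AddHom.coe_mk]
  congr 1 with p
  simp [ev]
  ring

/-- Christoffel modification by a degree-one factor `λ(x,y) = a x + b y`:
the short (Bäcklund-type) relations between the MOPS `{Pₙ}` of `W` and the MOPS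
`{Pₙ*}` of `W* = λ W`, for all `n ≥ 1` (here stated at index `n + 1`):
`P_{n+1} = P*_{n+1} + M_{n+1} P*_n` with
`M_{n+1} = 𝐏_{n+1} (a L_{n,1}ᵀ + b L_{n,2}ᵀ) (𝐏*_n)⁻¹`, and
`λ P*_{n+1} = (a L_{n+1,1} + b L_{n+1,2}) P_{n+2} + N_{n+1} P_{n+1}` with
`N_{n+1} = 𝐏*_{n+1} 𝐏_{n+1}⁻¹`. -/
theorem stmt5 (Ω : Set (ℝ × ℝ)) (W : ℝ × ℝ → ℝ) (a b : ℝ) (hab : |a| + |b| > 0)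
    (hW : IsWeight Ω W)
    (hWs : IsWeight Ω (fun p => (a * p.1 + b * p.2) * W p))
    (P Ps : (n : ℕ) → Fin (n + 1) → MvPolynomial (Fin 2) ℝ)
    (hP : IsMOPS Ω W P)
    (hPs : IsMOPS Ω (fun p => (a * p.1 + b * p.2) * W p) Ps)
    (Pmat Psmat : (n : ℕ) → Matrix (Fin (n + 1)) (Fin (n + 1)) ℝ)
    (hPmat : ∀ (n : ℕ) (i j : Fin (n + 1)),
      Pmat n i j = ∫ p in Ω, ev p (P n i) * ev p (P n j) * W p)
    (hPsmat : ∀ (n : ℕ) (i j : Fin (n + 1)),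
      Psmat n i j = ∫ p in Ω, ev p (Ps n i) * ev p (Ps n j) * ((a * p.1 + b * p.2) * W p))
    (hPinv : ∀ n : ℕ, IsUnit (Pmat n).det)
    (hPsinv : ∀ n : ℕ, IsUnit (Psmat n).det)
    (n : ℕ) :
    (∀ i : Fin (n + 2),
      P (n + 1) i = Ps (n + 1) i +
        ∑ j : Fin (n + 1),
          C ((Pmat (n + 1) * (a • (Lmat n 1)ᵀ + b • (Lmat n 2)ᵀ) * (Psmat n)⁻¹) i j) *
            Ps n j) ∧
    (∀ i : Fin (n + 2),
      (C a * X 0 + C b * X 1) * Ps (n + 1) i =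
        (∑ j : Fin (n + 3),
          C ((a • Lmat (n + 1) 1 + b • Lmat (n + 1) 2) i j) * P (n + 2) j) +
        ∑ j : Fin (n + 2), C ((Psmat (n + 1) * (Pmat (n + 1))⁻¹) i j) * P (n + 1) j) := by
  have hO : ∀ m n : ℕ, m ≠ n → ∀ (i : Fin (m + 1)) (j : Fin (n + 1)),
      moment hW (P m i * P n j) = 0 := fun m n h i j => by rw [moment_mul, hP.2 m n h]
  have hOs : ∀ m n : ℕ, m ≠ n → ∀ (i : Fin (m + 1)) (j : Fin (n + 1)),
      moment hWs (Ps m i * Ps n j) = 0 := fun m n h i j => by rw [moment_mul, hPs.2 m n h]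
  have hG : ∀ n, Pmat n = Matrix.of fun i j => moment hW (P n i * P n j) := fun n => by
    ext i j
    rw [hPmat, Matrix.of_apply, moment_mul]
  have hGs : ∀ n, Psmat n = Matrix.of fun i j => moment hWs (Ps n i * Ps n j) := fun n => by
    ext i j
    rw [hPsmat, Matrix.of_apply, moment_mul]
  simp only [hG] at hPinv
  simp only [hGs] at hPsinv
  constructor
  · intro i
    have hlin : ∀ m (k : Fin (m + 1)), moment hWs (P (n + 1) i * Ps m k) =
        moment hW ((C a * X 0 + C b * X 1) * Ps m k * P (n + 1) i) := fun m k => by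
      rw [← moment_linear_mul hW hWs, mul_assoc, mul_comm (Ps m k)]
    have hdiff : P (n + 1) i - Ps (n + 1) i ∈ degLT (n + 1) := by
      simpa using (degLT (n + 1)).sub_mem (hP.1 (n + 1) i).sub_mem_degLT
        (hPs.1 (n + 1) i).sub_mem_degLT
    have key := eq_sum_of_forall_map_mul_eq_zero hPs.1 hOs hPsinv hdiff fun m hm k => by
      rw [sub_mul, map_sub, hOs _ _ (by omega), sub_zero, hlin]
      exact map_mul_eq_zero_of_mem_degLT hP.1 hO (by omega)
        (linear_mul_mem_degLT a b (monic_mem_degLT hPs.1 m k)) i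
    rw [← hGs] at key
    rw [← sub_eq_iff_eq_add', key]
    refine Finset.sum_congr rfl fun j _ => ?_
    congr 3
    ext k
    rw [sub_mul, map_sub, hOs _ _ (by omega), sub_zero, hlin]
    have h := map_mul_eq_zero_of_mem_degLT hP.1 hO le_rfl
      (linear_mul_sub_sum_mem_degLT hP.1 hPs.1 a b n k) i
    rw [sub_mul, map_sub, map_sum_C_mul_mul, sub_eq_zero] at h
    rw [h]
    change _ = (Pmat (n + 1) * (a • (Lmat n 1)ᵀ + b • (Lmat n 2)ᵀ)) i k
    rw [Matrix.mul_apply, hG]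
    refine Finset.sum_congr rfl fun m _ => ?_
    simp [mul_comm]
  · intro i
    have key := eq_sum_of_forall_map_mul_eq_zero hP.1 hO hPinv
      (linear_mul_sub_sum_mem_degLT hP.1 hPs.1 a b (n + 1) i) fun m hm k => by
      rw [sub_mul, map_sub, map_sum_C_mul_mul, mul_assoc, moment_linear_mul hW hWs, mul_comm,
        map_mul_eq_zero_of_mem_degLT hPs.1 hOs (by omega) (monic_mem_degLT hP.1 m k)]
      simp [hO (n + 2) m (by omega)]
    rw [← hG] at key
    rw [← sub_eq_iff_eq_add', key]
    refine Finset.sum_congr rfl fun j _ => ?_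
    congr 3
    ext k
    rw [sub_mul, map_sub, map_sum_C_mul_mul, mul_assoc, moment_linear_mul hW hWs,
      Finset.sum_eq_zero (fun m _ => by rw [hO _ _ (by omega), mul_zero]), sub_zero, hGs,
      Matrix.of_apply, ← sub_eq_zero, ← map_sub, ← mul_sub, mul_comm]
    refine map_mul_eq_zero_of_mem_degLT hPs.1 hOs le_rfl ?_ i
    simpa using (degLT (n + 1)).sub_mem (hP.1 (n + 1) k).sub_mem_degLT
      (hPs.1 (n + 1) k).sub_mem_degLT
end
end

section
/- Let W be an xy-symmetric weight function on a measurable set Ω ⊆ ℝ² and let {Sₙ} be the MOPS of W on Ω. Suppose that for each n ≥ 0 and 0 ≤ k ≤ n there is a real bivariate polynomial p_{n,k} such that S_{2n,2k}(x,y) = p_{n,k}(x²,y²) for all (x,y). Then each p_{n,k} is monic with p_{n,k}(u,v) = u^{n−k} v^k + (terms of total degree < n), and the vectors P̂ₙ = (p_{n,0},…,p_{n,n})ᵀ form the MOPS of the weight W^{(0,0)} on Ω*: ∫_{Ω*} P̂ₙ(u,v) P̂ₘ(u,v)ᵀ W^{(0,0)}(u,v) du dv = 0 whenever n ≠ m.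 -/
noncomputable section

open MeasureTheory MvPolynomial

open Set

/-- Monicity of even degree descends from `f(x²,y²)` to `f`. -/
lemma MonicLead.of_expand {n k : ℕ} {f : MvPolynomial (Fin 2) ℝ}
    (h : MonicLead (2 * n) (2 * k) (expand 2 f)) : MonicLead n k f := by
  have hmon : (X 0 ^ (2 * n - 2 * k) * X 1 ^ (2 * k) : MvPolynomial (Fin 2) ℝ) =
      expand 2 (X 0 ^ (n - k) * X 1 ^ k) := by
    simp [← pow_mul, Nat.mul_sub]
  rw [MonicLead, hmon, ← map_sub, totalDegree_expand, expand_inj two_pos] at h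
  exact h.imp_right fun h => by omega

lemma integral_comp_abs_prod {F : ℝ × ℝ → ℝ}
    (hF : Integrable fun z : ℝ × ℝ => F (|z.1|, |z.2|)) :
    ∫ z : ℝ × ℝ, F (|z.1|, |z.2|) = 4 * ∫ z in Ioi (0 : ℝ) ×ˢ Ioi (0 : ℝ), F z := by
  have hQ : IntegrableOn F (Ioi (0 : ℝ) ×ˢ Ioi (0 : ℝ)) := by
    refine hF.integrableOn.congr_fun (fun z hz => ?_) (measurableSet_Ioi.prod measurableSet_Ioi)
    simp only [abs_of_pos (mem_Ioi.1 hz.1), abs_of_pos (mem_Ioi.1 hz.2)]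
  rw [Measure.volume_eq_prod] at hF hQ ⊢
  rw [integral_prod _ hF, setIntegral_prod _ hQ]
  simp_rw [fun x : ℝ => integral_comp_abs (f := fun y => F (|x|, y))]
  rw [integral_const_mul, integral_comp_abs (f := fun x => ∫ y in Ioi (0 : ℝ), F (x, y))]
  ring

lemma IsWeight.integrableOn_eval {Ω : Set (ℝ × ℝ)} {W : ℝ × ℝ → ℝ} (hW : IsWeight Ω W)
    (f : MvPolynomial (Fin 2) ℝ) : IntegrableOn (fun z => ev z f * W z) Ω := by
  simp only [ev, eval_eq', Finset.sum_mul]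
  refine integrable_finsetSum _ fun d _ => ?_
  simpa [mul_assoc] using (hW.2.2.2.2 (d 0) (d 1)).const_mul (f.coeff d)

lemma XYSymmetric.abs_mem_iff {Ω : Set (ℝ × ℝ)} {W : ℝ × ℝ → ℝ} (h : XYSymmetric Ω W)
    (z : ℝ × ℝ) : (|z.1|, |z.2|) ∈ Ω ↔ z ∈ Ω := by
  have h1 (x y : ℝ) : (-x, y) ∈ Ω ↔ (x, y) ∈ Ω :=
    ⟨fun hz => by simpa using (h.1 _ hz).1, fun hz => (h.1 _ hz).1⟩
  have h2 (x y : ℝ) : (x, -y) ∈ Ω ↔ (x, y) ∈ Ω :=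
    ⟨fun hz => by simpa using (h.1 _ hz).2, fun hz => (h.1 _ hz).2⟩
  rcases abs_choice z.1 with hx | hx <;> rcases abs_choice z.2 with hy | hy <;>
    simp [hx, hy, h1, h2]

lemma XYSymmetric.apply_abs {Ω : Set (ℝ × ℝ)} {W : ℝ × ℝ → ℝ} (h : XYSymmetric Ω W)
    {z : ℝ × ℝ} (hz : z ∈ Ω) : W (|z.1|, |z.2|) = W z := by
  have hz' := (h.1 z hz).1
  rcases abs_choice z.1 with hx | hx <;> rcases abs_choice z.2 with hy | hy <;> rw [hx, hy]
  · exact (h.2 z hz).2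
  · exact (h.2 z hz).1
  · exact ((h.2 _ hz').2).trans (h.2 z hz).1

/-- An even integrand on a symmetric domain integrates to four times its integral over the
open first quadrant. -/
lemma XYSymmetric.setIntegral_eq {Ω : Set (ℝ × ℝ)} {W : ℝ × ℝ → ℝ} (hW : IsWeight Ω W)
    (h : XYSymmetric Ω W) (f : MvPolynomial (Fin 2) ℝ) :
    ∫ z in Ω, ev (z.1 ^ 2, z.2 ^ 2) f * W z =
      4 * ∫ z in Ioi (0 : ℝ) ×ˢ Ioi (0 : ℝ) ∩ Ω, ev (z.1 ^ 2, z.2 ^ 2) f * W z := by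
  have habs : (fun z : ℝ × ℝ => Ω.indicator (fun z => ev (z.1 ^ 2, z.2 ^ 2) f * W z)
      (|z.1|, |z.2|)) = Ω.indicator fun z => ev (z.1 ^ 2, z.2 ^ 2) f * W z := by
    ext z
    by_cases hz : z ∈ Ω
    · rw [indicator_of_mem hz, indicator_of_mem ((h.abs_mem_iff z).2 hz), h.apply_abs hz]
      simp
    · rw [indicator_of_notMem hz, indicator_of_notMem (mt (h.abs_mem_iff z).1 hz)]
  have hint : IntegrableOn (fun z => ev (z.1 ^ 2, z.2 ^ 2) f * W z) Ω := by
    refine (hW.integrableOn_eval (expand 2 f)).congr_fun (fun z _ => ?_) hW.1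
    simp only [ev, eval_expand]
    congr 3
    ext i
    fin_cases i <;> simp
  have key := integral_comp_abs_prod (F := Ω.indicator fun z => ev (z.1 ^ 2, z.2 ^ 2) f * W z)
    (by rw [habs]; exact hint.integrable_indicator hW.1)
  rwa [habs, integral_indicator hW.1, setIntegral_indicator hW.1] at key

lemma measurableSet_Ωstar {Ω : Set (ℝ × ℝ)} (hΩ : MeasurableSet Ω) :
    MeasurableSet (Ωstar Ω) := by
  have h : Measurable fun q : ℝ × ℝ => (Real.sqrt q.1, Real.sqrt q.2) := by fun_prop
  exact (measurableSet_le measurable_const measurable_fst).inter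
    ((measurableSet_le measurable_const measurable_snd).inter (h hΩ))

lemma image_sq_eq {Ω : Set (ℝ × ℝ)} :
    (fun z : ℝ × ℝ => (z.1 ^ 2, z.2 ^ 2)) '' (Ioi (0 : ℝ) ×ˢ Ioi (0 : ℝ) ∩ Ω) =
      Ioi (0 : ℝ) ×ˢ Ioi (0 : ℝ) ∩ Ωstar Ω := by
  ext q
  constructor
  · rintro ⟨z, ⟨⟨hx, hy⟩, hz⟩, rfl⟩
    rw [mem_Ioi] at hx hy
    refine ⟨⟨pow_pos hx 2, pow_pos hy 2⟩, sq_nonneg _, sq_nonneg _, ?_⟩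
    simpa [Real.sqrt_sq hx.le, Real.sqrt_sq hy.le] using hz
  · rintro ⟨⟨hx, hy⟩, hu, hv, hq⟩
    exact ⟨(√q.1, √q.2), ⟨⟨Real.sqrt_pos.2 hx, Real.sqrt_pos.2 hy⟩, hq⟩,
      Prod.ext (Real.sq_sqrt hu) (Real.sq_sqrt hv)⟩

/-- The change of variables `(u, v) = (x², y²)`, with the weight `W00 W` absorbing the
Jacobian. -/
lemma setIntegral_Ωstar {Ω : Set (ℝ × ℝ)} (hΩ : MeasurableSet Ω) (W g : ℝ × ℝ → ℝ) :
    ∫ q in Ωstar Ω, g q * W00 W q =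
      ∫ z in Ioi (0 : ℝ) ×ˢ Ioi (0 : ℝ) ∩ Ω, g (z.1 ^ 2, z.2 ^ 2) * W z := by
  have hQ : MeasurableSet (Ioi (0 : ℝ) ×ˢ Ioi (0 : ℝ) ∩ Ω) :=
    (measurableSet_Ioi.prod measurableSet_Ioi).inter hΩ
  have hd (a : ℝ) : HasFDerivAt (fun x : ℝ => x ^ 2)
      ((2 * a) • ContinuousLinearMap.id ℝ ℝ) a := by
    have h := (hasDerivAt_pow 2 a).hasFDerivAt
    rwa [show ContinuousLinearMap.toSpanSingleton ℝ (((2 : ℕ) : ℝ) * a ^ (2 - 1)) =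
      (2 * a) • ContinuousLinearMap.id ℝ ℝ by ext; simp] at h
  have hdet (a b : ℝ) : (((2 * a) • ContinuousLinearMap.id ℝ ℝ).prodMap
      ((2 * b) • ContinuousLinearMap.id ℝ ℝ)).det = (2 * a) * (2 * b) := by
    simp [ContinuousLinearMap.det, ContinuousLinearMap.coe_prodMap, LinearMap.det_prodMap]
  have hinj : InjOn (fun z : ℝ × ℝ => (z.1 ^ 2, z.2 ^ 2)) (Ioi (0 : ℝ) ×ˢ Ioi (0 : ℝ) ∩ Ω) := by
    rintro z ⟨⟨hx, hy⟩, -⟩ w ⟨⟨hx', hy'⟩, -⟩ hzw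
    rw [Prod.mk.injEq] at hzw
    exact Prod.ext ((pow_left_inj₀ (le_of_lt hx) (le_of_lt hx') two_ne_zero).1 hzw.1)
      ((pow_left_inj₀ (le_of_lt hy) (le_of_lt hy') two_ne_zero).1 hzw.2)
  rw [setIntegral_eq_of_subset_of_forall_sdiff_eq_zero (measurableSet_Ωstar hΩ)
    (inter_subset_right (s := Ioi (0 : ℝ) ×ˢ Ioi (0 : ℝ))), ← image_sq_eq,
    integral_image_eq_integral_abs_det_fderiv_smul volume
      (f := fun z : ℝ × ℝ => (z.1 ^ 2, z.2 ^ 2)) hQ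
      (fun z _ => ((hd z.1).prodMap z (hd z.2)).hasFDerivWithinAt) hinj]
  · refine setIntegral_congr_fun hQ ?_
    rintro ⟨x, y⟩ ⟨⟨hx, hy⟩, -⟩
    simp only [mem_Ioi] at hx hy
    simp only [hdet, W00, smul_eq_mul, Real.sqrt_sq hx.le, Real.sqrt_sq hy.le, ← mul_pow,
      Real.sqrt_sq (mul_pos hx hy).le,
      abs_of_pos (show 0 < 2 * x * (2 * y) by positivity)]
    field_simp
    ring
  · rintro q ⟨⟨hx, hy, hq⟩, hn⟩
    have : q.1 * q.2 = 0 := by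
      by_contra hne
      obtain ⟨hx0, hy0⟩ := mul_ne_zero_iff.1 hne
      exact hn ⟨⟨hx.lt_of_ne' hx0, hy.lt_of_ne' hy0⟩, hx, hy, hq⟩
    simp [W00, this]

/-- If `{Sₙ}` is the MOPS of an `xy`-symmetric weight `W` on `Ω` and
`S_{2n,2k}(x,y) = p_{n,k}(x²,y²)`, then the `p_{n,k}` are monic with leading term
`u^(n-k) v^k` and the vectors `(p_{n,0},…,p_{n,n})ᵀ` form the MOPS of the weight
`W^(0,0)` on `Ω*`. -/
theorem stmt7 (Ω : Set (ℝ × ℝ)) (W : ℝ × ℝ → ℝ) (hW : IsWeight Ω W)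
    (hsym : XYSymmetric Ω W)
    (S : (n : ℕ) → Fin (n + 1) → MvPolynomial (Fin 2) ℝ) (hS : IsMOPS Ω W S)
    (p : (n : ℕ) → Fin (n + 1) → MvPolynomial (Fin 2) ℝ)
    (hrel : ∀ (n : ℕ) (k : Fin (n + 1)) (x y : ℝ),
      eval ![x, y] (S (2 * n) ⟨2 * (k : ℕ), by have := k.isLt; omega⟩) =
        eval ![x ^ 2, y ^ 2] (p n k)) :
    IsMOPS (Ωstar Ω) (W00 W) p := by
  have hexp (n : ℕ) (k : Fin (n + 1)) :
      expand 2 (p n k) = S (2 * n) ⟨2 * (k : ℕ), by have := k.isLt; omega⟩ := by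
    refine MvPolynomial.funext fun x => ?_
    have hx : x = ![x 0, x 1] := by ext i; fin_cases i <;> rfl
    rw [eval_expand, hx, hrel]
    congr 2
    ext i
    fin_cases i <;> simp
  refine ⟨fun n j => MonicLead.of_expand (hexp n j ▸ hS.1 _ _), fun m n hmn i j => ?_⟩
  have horth := hS.2 (2 * m) (2 * n) (by omega) ⟨2 * (i : ℕ), by omega⟩ ⟨2 * (j : ℕ), by omega⟩
  have hsq := hsym.setIntegral_eq hW (p m i * p n j)
  simp only [ev, hrel] at horth
  simp only [ev, map_mul, horth] at hsq
  rw [setIntegral_Ωstar hW.1 W fun q => ev q (p m i) * ev q (p n j)]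
  simp only [ev]
  linarith
end
end

section
/- Let Ŵ be a weight function on a measurable set Ω* ⊆ {(u,v) ∈ ℝ² : u ≥ 0, v ≥ 0}, and let {P̂ₙ^{(0,0)}}, {P̂ₙ^{(1,0)}}, {P̂ₙ^{(0,1)}}, {P̂ₙ^{(1,1)}} be the MOPS of the weights Ŵ, u·Ŵ, v·Ŵ, and u·v·Ŵ on Ω* respectively (assumed to be weight functions). Set Ω = {(x,y) ∈ ℝ² : (x²,y²) ∈ Ω*} and W(x,y) = 4·|x|·|y|·Ŵ(x²,y²). Define, for n ≥ 0 and 0-indexed entries: S_{2n,2k}(x,y) = P̂^{(0,0)}_{n,k}(x²,y²) for 0 ≤ k ≤ n; S_{2n,2k+1}(x,y) = x·y·P̂^{(1,1)}_{n−1,k}(x²,y²) for 0 ≤ k ≤ n−1; S_{2n+1,2k}(x,y) = x·P̂^{(1,0)}_{n,k}(x²,y²) and S_{2n+1,2k+1}(x,y) = y·P̂^{(0,1)}_{n,k}(x²,y²) for 0 ≤ k ≤ n. Then {Sₙ}, with Sₙ = (S_{n,0},…,S_{n,n})ᵀ, is the MOPS of the weight W on Ω: each S_{n,j} is monic with leading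 term x^{n−j} y^j, and ∫_Ω Sₙ(x,y) Sₘ(x,y)ᵀ W(x,y) dx dy = 0 whenever n ≠ m. -/
noncomputable section

open MeasureTheory MvPolynomial

/-- The coordinatewise squaring map of the plane. -/
def sqMap (p : ℝ × ℝ) : ℝ × ℝ := (p.1 ^ 2, p.2 ^ 2)

/-- The derivative of `sqMap`. -/
def fderivSqMap (p : ℝ × ℝ) : ℝ × ℝ →L[ℝ] ℝ × ℝ :=
  (Matrix.toLin (.finTwoProd ℝ) (.finTwoProd ℝ)
    !![2 * p.1, 0; 0, 2 * p.2]).toContinuousLinearMap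

theorem hasFDerivAt_sqMap (p : ℝ × ℝ) : HasFDerivAt sqMap (fderivSqMap p) p := by
  unfold fderivSqMap
  rw [Matrix.toLin_finTwoProd_toContinuousLinearMap]
  have h₁ : HasFDerivAt (fun q : ℝ × ℝ => q.1 ^ 2) _ p :=
    (hasFDerivAt_fst (𝕜 := ℝ) (p := p)).pow 2
  have h₂ : HasFDerivAt (fun q : ℝ × ℝ => q.2 ^ 2) _ p :=
    (hasFDerivAt_snd (𝕜 := ℝ) (p := p)).pow 2
  convert! h₁.prodMk h₂ using 2 <;> simp

theorem abs_det_fderivSqMap (p : ℝ × ℝ) : |(fderivSqMap p).det| = 4 * |p.1| * |p.2| := by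
  unfold fderivSqMap
  simp only [LinearMap.det_toContinuousLinearMap, LinearMap.det_toLin, Matrix.det_fin_two_of]
  simp only [mul_zero, sub_zero, abs_mul, abs_two]
  ring

theorem measurable_sqMap : Measurable sqMap := by
  unfold sqMap
  fun_prop

/-- The open quadrant with signs `s` and `t`. -/
def quadrant (s t : ℝ) : Set (ℝ × ℝ) := {p | 0 < s * p.1 ∧ 0 < t * p.2}

theorem measurableSet_quadrant (s t : ℝ) : MeasurableSet (quadrant s t) := by
  have h₁ : Measurable fun p : ℝ × ℝ => s * p.1 := by fun_prop
  have h₂ : Measurable fun p : ℝ × ℝ => t * p.2 := by fun_prop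
  exact (measurableSet_lt measurable_const h₁).inter (measurableSet_lt measurable_const h₂)

theorem injOn_sqMap_quadrant (s t : ℝ) : Set.InjOn sqMap (quadrant s t) := by
  have inj {r a b : ℝ} (ha : 0 < r * a) (hb : 0 < r * b) (h : a ^ 2 = b ^ 2) : a = b := by
    rcases sq_eq_sq_iff_eq_or_eq_neg.mp h with h | h
    · exact h
    · subst h
      linarith
  rintro ⟨a, b⟩ ⟨ha, hb⟩ ⟨c, d⟩ ⟨hc, hd⟩ h
  simp only [sqMap, Prod.mk.injEq] at h
  exact Prod.ext (inj ha hc h.1) (inj hb hd h.2)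

theorem sqMap_image_inter_quadrant (A : Set (ℝ × ℝ)) {s t : ℝ} (hs : s ^ 2 = 1) (ht : t ^ 2 = 1) :
    sqMap '' (sqMap ⁻¹' A ∩ quadrant s t) = A ∩ quadrant 1 1 := by
  have pos {r a : ℝ} (h : 0 < r * a) : 0 < a ^ 2 := by
    have : a ≠ 0 := by rintro rfl; simp at h
    positivity
  ext ⟨u, v⟩
  constructor
  · rintro ⟨⟨a, b⟩, ⟨hA, ha, hb⟩, h⟩
    rw [← h]
    exact ⟨hA, by simpa [sqMap] using pos ha, by simpa [sqMap] using pos hb⟩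
  · rintro ⟨hA, hu, hv⟩
    simp only [one_mul] at hu hv
    have h : sqMap (s * √u, t * √v) = (u, v) := by
      simp [sqMap, mul_pow, hs, ht, Real.sq_sqrt, hu.le, hv.le]
    refine ⟨(s * √u, t * √v), ⟨by rwa [Set.mem_preimage, h], ?_, ?_⟩, h⟩
    · change 0 < s * (s * √u)
      rw [← mul_assoc, ← sq, hs, one_mul]
      exact Real.sqrt_pos.mpr hu
    · change 0 < t * (t * √v)
      rw [← mul_assoc, ← sq, ht, one_mul]
      exact Real.sqrt_pos.mpr hv

theorem setIntegral_quadrant_comp_sqMap {A : Set (ℝ × ℝ)} (hA : MeasurableSet A) {s t : ℝ}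
    (hs : s ^ 2 = 1) (ht : t ^ 2 = 1) (g : ℝ × ℝ → ℝ) :
    ∫ p in sqMap ⁻¹' A ∩ quadrant s t, 4 * |p.1| * |p.2| * g (sqMap p) =
      ∫ q in A ∩ quadrant 1 1, g q := by
  rw [← sqMap_image_inter_quadrant A hs ht,
    integral_image_eq_integral_abs_det_fderiv_smul volume
      ((measurable_sqMap hA).inter (measurableSet_quadrant s t))
      (fun p _ => (hasFDerivAt_sqMap p).hasFDerivWithinAt)
      ((injOn_sqMap_quadrant s t).mono Set.inter_subset_right)]
  simp only [abs_det_fderivSqMap, smul_eq_mul]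

theorem setIntegral_inter_quadrant {A : Set (ℝ × ℝ)} (hA : ∀ q ∈ A, 0 ≤ q.1 ∧ 0 ≤ q.2)
    (g : ℝ × ℝ → ℝ) : ∫ q in A ∩ quadrant 1 1, g q = ∫ q in A, g q := by
  have h₁ : ∀ᵐ q : ℝ × ℝ, q.1 ≠ 0 :=
    Measure.quasiMeasurePreserving_fst.ae (Measure.ae_ne volume (0 : ℝ))
  have h₂ : ∀ᵐ q : ℝ × ℝ, q.2 ≠ 0 :=
    Measure.quasiMeasurePreserving_snd.ae (Measure.ae_ne volume (0 : ℝ))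
  apply setIntegral_congr_set
  filter_upwards [h₁, h₂] with q hq₁ hq₂
  refine propext ⟨fun h => h.1, fun h => ⟨h, ?_, ?_⟩⟩
  · simpa using lt_of_le_of_ne (hA q h).1 hq₁.symm
  · simpa using lt_of_le_of_ne (hA q h).2 hq₂.symm

theorem setIntegral_union_eq_zero {α : Type*} [MeasurableSpace α] {μ : Measure α} {A B : Set α}
    {f : α → ℝ} (hB : MeasurableSet B) (hAB : Disjoint A B)
    (hfA : ∫ x in A, f x ∂μ = 0) (hfB : ∫ x in B, f x ∂μ = 0) :
    ∫ x in A ∪ B, f x ∂μ = 0 := by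
  by_cases hf : IntegrableOn f (A ∪ B) μ
  · rw [setIntegral_union hAB hB hf.left_of_union hf.right_of_union, hfA, hfB, add_zero]
  · exact integral_undef hf

theorem setIntegral_comp_sqMap_eq_zero {A : Set (ℝ × ℝ)} (hA : MeasurableSet A)
    (hpos : ∀ q ∈ A, 0 ≤ q.1 ∧ 0 ≤ q.2) {g : ℝ × ℝ → ℝ} (hg : ∫ q in A, g q = 0) :
    ∫ p in sqMap ⁻¹' A, 4 * |p.1| * |p.2| * g (sqMap p) = 0 := by
  have hq {s t : ℝ} (hs : s ^ 2 = 1) (ht : t ^ 2 = 1) :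
      ∫ p in sqMap ⁻¹' A ∩ quadrant s t, 4 * |p.1| * |p.2| * g (sqMap p) = 0 := by
    rw [setIntegral_quadrant_comp_sqMap hA hs ht, setIntegral_inter_quadrant hpos, hg]
  have hm (s t : ℝ) : MeasurableSet (sqMap ⁻¹' A ∩ quadrant s t) :=
    (measurable_sqMap hA).inter (measurableSet_quadrant s t)
  have hd {s t s' t' : ℝ} (h : s' = -s ∨ t' = -t) :
      Disjoint (sqMap ⁻¹' A ∩ quadrant s t) (sqMap ⁻¹' A ∩ quadrant s' t') := by
    rw [Set.disjoint_left]
    rintro p ⟨-, h₁, h₂⟩ ⟨-, h₃, h₄⟩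
    rcases h with rfl | rfl <;> linarith
  have hU := setIntegral_union_eq_zero ((hm (-1) 1).union (hm (-1) (-1)))
    (((hd (.inl rfl)).union_right (hd (.inl rfl))).union_left
      ((hd (.inl rfl)).union_right (hd (.inl rfl))))
    (setIntegral_union_eq_zero (hm 1 (-1)) (hd (.inr rfl)) (hq (s := 1) (t := 1) (by norm_num)
      (by norm_num)) (hq (by norm_num) (by norm_num)))
    (setIntegral_union_eq_zero (hm (-1) (-1)) (hd (.inr rfl)) (hq (by norm_num) (by norm_num))
      (hq (by norm_num) (by norm_num)))
  rw [← hU]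
  refine setIntegral_eq_of_subset_of_forall_sdiff_eq_zero (measurable_sqMap hA) ?_ ?_
  · rintro p ((h | h) | (h | h)) <;> exact h.1
  · rintro p ⟨hp, hn⟩
    rcases lt_trichotomy p.1 0 with h₁ | h₁ | h₁
    · rcases lt_trichotomy p.2 0 with h₂ | h₂ | h₂
      · exact absurd (.inr (.inr ⟨hp, by linarith, by linarith⟩)) hn
      · simp [h₂]
      · exact absurd (.inr (.inl ⟨hp, by linarith, by linarith⟩)) hn
    · simp [h₁]
    · rcases lt_trichotomy p.2 0 with h₂ | h₂ | h₂
      · exact absurd (.inl (.inr ⟨hp, by linarith, by linarith⟩)) hn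
      · simp [h₂]
      · exact absurd (.inl (.inl ⟨hp, by linarith, by linarith⟩)) hn

theorem setIntegral_eq_zero_of_anti {α : Type*} [MeasurableSpace α] {μ : Measure α}
    {φ : α → α} (hφ : MeasurePreserving φ μ μ) (hφe : MeasurableEmbedding φ) {A : Set α}
    (hA : φ ⁻¹' A = A) {f : α → ℝ} (hf : ∀ x, f (φ x) = -f x) : ∫ x in A, f x ∂μ = 0 := by
  have h := hφ.setIntegral_preimage_emb hφe f A
  simp only [hA, hf, integral_neg] at h
  linarith

theorem setIntegral_sqMap_preimage_eq_zero_of_odd_fst (A : Set (ℝ × ℝ)) {f : ℝ × ℝ → ℝ}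
    (hf : ∀ x y, f (-x, y) = -f (x, y)) : ∫ p in sqMap ⁻¹' A, f p = 0 := by
  let e := (MeasurableEquiv.neg ℝ).prodCongr (MeasurableEquiv.refl ℝ)
  refine setIntegral_eq_zero_of_anti (φ := e)
    ((Measure.measurePreserving_neg volume).prod (MeasurePreserving.id _))
    e.measurableEmbedding ?_ (fun p => hf p.1 p.2)
  ext ⟨x, y⟩
  change sqMap (-x, y) ∈ A ↔ sqMap (x, y) ∈ A
  simp [sqMap]

theorem setIntegral_sqMap_preimage_eq_zero_of_odd_snd (A : Set (ℝ × ℝ)) {f : ℝ × ℝ → ℝ}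
    (hf : ∀ x y, f (x, -y) = -f (x, y)) : ∫ p in sqMap ⁻¹' A, f p = 0 := by
  let e := (MeasurableEquiv.refl ℝ).prodCongr (MeasurableEquiv.neg ℝ)
  refine setIntegral_eq_zero_of_anti (φ := e)
    ((MeasurePreserving.id _).prod (Measure.measurePreserving_neg volume))
    e.measurableEmbedding ?_ (fun p => hf p.1 p.2)
  ext ⟨x, y⟩
  change sqMap (x, -y) ∈ A ↔ sqMap (x, y) ∈ A
  simp [sqMap]

theorem eq_mul_expand_of_eval {f g : MvPolynomial (Fin 2) ℝ} {a b : ℕ}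
    (h : ∀ x y : ℝ, eval ![x, y] f = x ^ a * y ^ b * eval ![x ^ 2, y ^ 2] g) :
    f = X 0 ^ a * X 1 ^ b * expand 2 g := by
  refine MvPolynomial.funext fun v => ?_
  have hv : v = ![v 0, v 1] := by
    ext i
    fin_cases i <;> rfl
  have hv2 : v ^ 2 = ![v 0 ^ 2, v 1 ^ 2] := by
    ext i
    fin_cases i <;> rfl
  have h' := h (v 0) (v 1)
  rw [← hv, ← hv2] at h'
  simp [h', eval_expand]

theorem MonicLead.mul_expand {n k : ℕ} {g : MvPolynomial (Fin 2) ℝ} (hk : k ≤ n)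
    (hg : MonicLead n k g) (a b : ℕ) :
    MonicLead (2 * n + a + b) (2 * k + b) (X 0 ^ a * X 1 ^ b * expand 2 g) := by
  have hlead : (X 0 ^ (2 * n + a + b - (2 * k + b)) * X 1 ^ (2 * k + b) :
      MvPolynomial (Fin 2) ℝ) =
      X 0 ^ a * X 1 ^ b * expand 2 (X 0 ^ (n - k) * X 1 ^ k) := by
    rw [show 2 * n + a + b - (2 * k + b) = a + 2 * (n - k) by omega]
    simp only [map_mul, map_pow, expand_X]
    ring
  unfold MonicLead
  rw [hlead]
  rcases hg with hg | hg
  · exact .inl (by rw [hg])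
  · right
    rw [← mul_sub, ← map_sub]
    have h₁ := totalDegree_mul (X 0 ^ a * X 1 ^ b : MvPolynomial (Fin 2) ℝ)
      (expand 2 (g - X 0 ^ (n - k) * X 1 ^ k))
    have h₂ := totalDegree_mul (X 0 ^ a : MvPolynomial (Fin 2) ℝ) (X 1 ^ b)
    rw [totalDegree_X_pow, totalDegree_X_pow] at h₂
    rw [totalDegree_expand] at h₁
    omega

/-- Converse construction: from the MOPS of a weight `Ŵ` on `Ω* ⊆ ℝ²₊` and of its
Christoffel modifications `u Ŵ`, `v Ŵ`, `u v Ŵ`, the zipped family `{Sₙ}` defined by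
`S_{2n,2k} = P̂⁽⁰'⁰⁾_{n,k}(x²,y²)`, `S_{2n+2,2k+1} = x y P̂⁽¹'¹⁾_{n,k}(x²,y²)`,
`S_{2n+1,2k} = x P̂⁽¹'⁰⁾_{n,k}(x²,y²)`, `S_{2n+1,2k+1} = y P̂⁽⁰'¹⁾_{n,k}(x²,y²)`
is the MOPS of the `xy`-symmetric weight `W(x,y) = 4 |x| |y| Ŵ(x²,y²)` on
`Ω = {(x,y) : (x²,y²) ∈ Ω*}`. -/
theorem stmt11 (Ωs : Set (ℝ × ℝ)) (Wh : ℝ × ℝ → ℝ)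
    (hsub : ∀ q ∈ Ωs, 0 ≤ q.1 ∧ 0 ≤ q.2)
    (hW00 : IsWeight Ωs Wh)
    (hW10 : IsWeight Ωs (fun q => q.1 * Wh q))
    (hW01 : IsWeight Ωs (fun q => q.2 * Wh q))
    (hW11 : IsWeight Ωs (fun q => q.1 * q.2 * Wh q))
    (P00 P10 P01 P11 : (n : ℕ) → Fin (n + 1) → MvPolynomial (Fin 2) ℝ)
    (hP00 : IsMOPS Ωs Wh P00)
    (hP10 : IsMOPS Ωs (fun q => q.1 * Wh q) P10)
    (hP01 : IsMOPS Ωs (fun q => q.2 * Wh q) P01)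
    (hP11 : IsMOPS Ωs (fun q => q.1 * q.2 * Wh q) P11)
    (S : (n : ℕ) → Fin (n + 1) → MvPolynomial (Fin 2) ℝ)
    (hSee : ∀ (n : ℕ) (k : Fin (n + 1)) (x y : ℝ),
      eval ![x, y] (S (2 * n) ⟨2 * (k : ℕ), by have := k.isLt; omega⟩) =
        eval ![x ^ 2, y ^ 2] (P00 n k))
    (hSeo : ∀ (n : ℕ) (k : Fin (n + 1)) (x y : ℝ),
      eval ![x, y] (S (2 * n + 2) ⟨2 * (k : ℕ) + 1, by have := k.isLt; omega⟩) =
        x * y * eval ![x ^ 2, y ^ 2] (P11 n k))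
    (hSoe : ∀ (n : ℕ) (k : Fin (n + 1)) (x y : ℝ),
      eval ![x, y] (S (2 * n + 1) ⟨2 * (k : ℕ), by have := k.isLt; omega⟩) =
        x * eval ![x ^ 2, y ^ 2] (P10 n k))
    (hSoo : ∀ (n : ℕ) (k : Fin (n + 1)) (x y : ℝ),
      eval ![x, y] (S (2 * n + 1) ⟨2 * (k : ℕ) + 1, by have := k.isLt; omega⟩) =
        y * eval ![x ^ 2, y ^ 2] (P01 n k)) :
    IsMOPS {p : ℝ × ℝ | (p.1 ^ 2, p.2 ^ 2) ∈ Ωs}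
      (fun p => 4 * |p.1| * |p.2| * Wh (p.1 ^ 2, p.2 ^ 2)) S := by
  let Q : Bool → Bool → (n : ℕ) → Fin (n + 1) → MvPolynomial (Fin 2) ℝ := fun a b =>
    match a, b with
    | false, false => P00
    | true, false => P10
    | false, true => P01
    | true, true => P11
  have hQ (a b : Bool) :
      IsMOPS Ωs (fun q => q.1 ^ a.toNat * q.2 ^ b.toNat * Wh q) (Q a b) := by
    cases a <;> cases b <;> simpa [Q]
  have hS (N : ℕ) (j : Fin (N + 1)) : ∃ (a b : Bool) (n : ℕ) (k : Fin (n + 1)),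
      N = 2 * n + a.toNat + b.toNat ∧ (j : ℕ) = 2 * k + b.toNat ∧
        S N j = X 0 ^ a.toNat * X 1 ^ b.toNat * expand 2 (Q a b n k) := by
    obtain ⟨j, hj⟩ := j
    obtain ⟨n, rfl | rfl⟩ := N.even_or_odd'
    · obtain ⟨k, rfl | rfl⟩ := j.even_or_odd'
      · refine ⟨false, false, n, ⟨k, by omega⟩, by simp, by simp, eq_mul_expand_of_eval ?_⟩
        intro x y
        simpa [Q] using hSee n ⟨k, by omega⟩ x y
      · obtain ⟨n, rfl⟩ : ∃ m, n = m + 1 := ⟨n - 1, by omega⟩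
        refine ⟨true, true, n, ⟨k, by omega⟩, by simp; ring, by simp, eq_mul_expand_of_eval ?_⟩
        intro x y
        exact (hSeo n ⟨k, by omega⟩ x y).trans (by simp [Q])
    · obtain ⟨k, rfl | rfl⟩ := j.even_or_odd'
      · refine ⟨true, false, n, ⟨k, by omega⟩, by simp, by simp, eq_mul_expand_of_eval ?_⟩
        intro x y
        simpa [Q] using hSoe n ⟨k, by omega⟩ x y
      · refine ⟨false, true, n, ⟨k, by omega⟩, by simp, by simp, eq_mul_expand_of_eval ?_⟩
        intro x y
        simpa [Q] using hSoo n ⟨k, by omega⟩ x y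
  have hev (x y : ℝ) (a b : ℕ) (g : MvPolynomial (Fin 2) ℝ) :
      ev (x, y) (X 0 ^ a * X 1 ^ b * expand 2 g) = x ^ a * y ^ b * ev (x ^ 2, y ^ 2) g := by
    have h2 : (![x, y] : Fin 2 → ℝ) ^ 2 = ![x ^ 2, y ^ 2] := by
      ext i
      fin_cases i <;> rfl
    simp [ev, eval_expand, h2]
  refine ⟨fun N j => ?_, fun M N hMN i j => ?_⟩
  · obtain ⟨a, b, n, k, rfl, hj, h⟩ := hS N j
    rw [h, hj]
    exact ((hQ a b).1 n k).mul_expand (Nat.lt_succ_iff.mp k.isLt) _ _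
  · obtain ⟨a, b, m, k, hM, -, h⟩ := hS M i
    obtain ⟨c, d, n, l, hN, -, h'⟩ := hS N j
    rw [h, h']
    change ∫ p in sqMap ⁻¹' Ωs, _ = 0
    by_cases hac : a = c
    · by_cases hbd : b = d
      · subst hac hbd
        rw [← setIntegral_comp_sqMap_eq_zero hW00.1 hsub
          ((hQ a b).2 m n (by omega) k l)]
        congr 1 with p
        obtain ⟨x, y⟩ := p
        simp only [hev, sqMap]
        ring
      · refine setIntegral_sqMap_preimage_eq_zero_of_odd_snd _ fun x y => ?_
        simp only [hev, neg_sq, abs_neg]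
        cases b <;> cases d <;> simp_all
    · refine setIntegral_sqMap_preimage_eq_zero_of_odd_fst _ fun x y => ?_
      simp only [hev, neg_sq, abs_neg]
      cases a <;> cases c <;> simp_all
end
end

section
/- Under the quadratic-decomposition setup, the four 'big' polynomial families satisfy, as identities of vectors of polynomials in (u,v), for all n ≥ 0 and k ∈ {1,2} (writing u₁ = u, u₂ = v, and with vectors of negative index equal to 0): (i) P^{(0,0)}ₙ = L_{2n,k} P^{(2−k,k−1)}ₙ + Γ_{2n,k} P^{(2−k,k−1)}_{n−1}; (ii) u_k · P^{(1,1)}_{n−1} = L_{2n,k} P^{(k−1,2−k)}ₙ + Γ_{2n,k} P^{(k−1,2−k)}_{n−1}; (iii) P^{(k−1,2−k)}ₙ = L_{2n+1,k} P^{(1,1)}ₙ + Γ_{2n+1,k} P^{(1,1)}_{n−1}; (iv) u_k · P^{(2−k,k−1)}ₙ = L_{2n+1,k} P^{(0,0)}_{n+1} + Γ_{2n+1,k} P^{(0,0)}ₙ. -/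
noncomputable section

open MvPolynomial Finset

/-- Entry `(h, m)` of the matrix `L_{n,k}` (`k = 1, 2`): `1` iff `m = h + (k-1)`. -/
def Lent (k h m : ℕ) : ℝ := if m = h + (k - 1) then 1 else 0

/-- Entry `(h, m)` of the matrix `J_n^(i,j)`: `1` iff `m = 2 h + j`. -/
def Jent (j h m : ℕ) : ℝ := if m = 2 * h + j then 1 else 0

/-- Two real polynomials in two variables that agree at `(x², y²)` for all positive `x`, `y`
are equal. -/
theorem MvPolynomial.eq_of_eval_sq_eq {p q : MvPolynomial (Fin 2) ℝ}
    (h : ∀ x y : ℝ, 0 < x → 0 < y → eval ![x ^ 2, y ^ 2] p = eval ![x ^ 2, y ^ 2] q) :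
    p = q := by
  refine funext_set (fun _ => Set.Ioi 0) (fun _ => Set.Ioi_infinite 0) fun z hz => ?_
  have h0 : 0 < z 0 := hz 0 trivial
  have h1 : 0 < z 1 := hz 1 trivial
  have hz' : z = ![√(z 0) ^ 2, √(z 1) ^ 2] := by
    ext i
    fin_cases i
    · simp [Real.sq_sqrt h0.le]
    · simp [Real.sq_sqrt h1.le]
  rw [hz']
  exact h _ _ (Real.sqrt_pos.2 h0) (Real.sqrt_pos.2 h1)

/-- Uniqueness of the decomposition `x p(x², y²) + y q(x², y²)`. -/
theorem MvPolynomial.eq_and_eq_of_odd_decomposition {p q p' q' : MvPolynomial (Fin 2) ℝ}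
    (h : ∀ x y : ℝ,
      x * eval ![x ^ 2, y ^ 2] p + y * eval ![x ^ 2, y ^ 2] q =
        x * eval ![x ^ 2, y ^ 2] p' + y * eval ![x ^ 2, y ^ 2] q') :
    p = p' ∧ q = q' := by
  constructor <;> refine eq_of_eval_sq_eq fun x y hx hy => ?_ <;>
    have h₁ := h x y <;> have h₂ := h (-x) y <;> rw [neg_sq] at h₂
  · exact mul_left_cancel₀ hx.ne' (by linarith)
  · exact mul_left_cancel₀ hy.ne' (by linarith)

/-- Uniqueness of the decomposition `p(x², y²) + x y q(x², y²)`. -/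
theorem MvPolynomial.eq_and_eq_of_even_decomposition {p q p' q' : MvPolynomial (Fin 2) ℝ}
    (h : ∀ x y : ℝ,
      eval ![x ^ 2, y ^ 2] p + x * y * eval ![x ^ 2, y ^ 2] q =
        eval ![x ^ 2, y ^ 2] p' + x * y * eval ![x ^ 2, y ^ 2] q') :
    p = p' ∧ q = q' := by
  constructor <;> refine eq_of_eval_sq_eq fun x y hx hy => ?_ <;>
    have h₁ := h x y <;> have h₂ := h (-x) y <;> rw [neg_sq] at h₂
  · linarith
  · exact mul_left_cancel₀ (mul_pos hx hy).ne' (by linarith)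

/-- A linear combination of quantities of the form `a f + b g` splits accordingly. -/
theorem Finset.sum_mul_eq_of_forall_eq_add {s : Finset ℕ} {c t f g : ℕ → ℝ} {a b : ℝ}
    (h : ∀ j ∈ s, t j = a * f j + b * g j) :
    ∑ j ∈ s, c j * t j = a * ∑ j ∈ s, c j * f j + b * ∑ j ∈ s, c j * g j := by
  rw [mul_sum, mul_sum, ← sum_add_distrib]
  exact sum_congr rfl fun j hj => by rw [h j hj]; ring

/-- The entry of `L F + Γ G` determined by the row `c` of `L` and the row `d` of `Γ`. -/
def rowCombination (a b : ℕ) (c d : ℕ → ℝ) (F G : ℕ → MvPolynomial (Fin 2) ℝ) :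
    MvPolynomial (Fin 2) ℝ :=
  ∑ j ∈ range a, C (c j) * F j + ∑ j ∈ range b, C (d j) * G j

theorem eval_rowCombination (a b : ℕ) (c d : ℕ → ℝ) (F G : ℕ → MvPolynomial (Fin 2) ℝ)
    (z : Fin 2 → ℝ) :
    eval z (rowCombination a b c d F G) =
      ∑ j ∈ range a, c j * eval z (F j) + ∑ j ∈ range b, d j * eval z (G j) := by
  simp [rowCombination]

/-- Short relations between the four 'big' families of the quadratic decomposition
(Lemma `ShortRel_BigPoly`): for all `n ≥ 0`, `k ∈ {1,2}` (with `u₁ = u`, `u₂ = v`,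
vectors of negative index being `0`):
(i)   `P⁽⁰'⁰⁾ₙ = L_{2n,k} P^(2-k,k-1)ₙ + Γ_{2n,k} P^(2-k,k-1)_{n-1}`;
(ii)  `u_k P⁽¹'¹⁾_{n-1} = L_{2n,k} P^(k-1,2-k)ₙ + Γ_{2n,k} P^(k-1,2-k)_{n-1}`;
(iii) `P^(k-1,2-k)ₙ = L_{2n+1,k} P⁽¹'¹⁾ₙ + Γ_{2n+1,k} P⁽¹'¹⁾_{n-1}`;
(iv)  `u_k P^(2-k,k-1)ₙ = L_{2n+1,k} P⁽⁰'⁰⁾_{n+1} + Γ_{2n+1,k} P⁽⁰'⁰⁾ₙ`,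
as identities of (vectors of) polynomials in `(u,v)`, stated entrywise via evaluation. -/
theorem stmt12
    (Γ : ℕ → ℕ → ℕ → ℕ → ℝ)
    (S : ℕ → ℕ → MvPolynomial (Fin 2) ℝ)
    (P00 P11 P10 P01 : ℤ → ℕ → MvPolynomial (Fin 2) ℝ)
    (hneg : ∀ m : ℤ, m < 0 → ∀ i : ℕ,
      P00 m i = 0 ∧ P11 m i = 0 ∧ P10 m i = 0 ∧ P01 m i = 0)
    (hTTR : ∀ (N k : ℕ), k = 1 ∨ k = 2 → ∀ i < N + 1, ∀ x y : ℝ,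
      (if k = 1 then x else y) * eval ![x, y] (S N i) =
        (∑ j ∈ range (N + 2), Lent k i j * eval ![x, y] (S (N + 1) j)) +
        ∑ j ∈ range N, Γ N k i j * eval ![x, y] (S (N - 1) j))
    (hEven : ∀ (N : ℕ), ∀ i < 2 * N + 1, ∀ x y : ℝ,
      eval ![x, y] (S (2 * N) i) =
        eval ![x ^ 2, y ^ 2] (P00 (N : ℤ) i) +
          x * y * eval ![x ^ 2, y ^ 2] (P11 ((N : ℤ) - 1) i))
    (hOdd : ∀ (N : ℕ), ∀ i < 2 * N + 2, ∀ x y : ℝ,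
      eval ![x, y] (S (2 * N + 1) i) =
        x * eval ![x ^ 2, y ^ 2] (P10 (N : ℤ) i) +
          y * eval ![x ^ 2, y ^ 2] (P01 (N : ℤ) i))
    (n k : ℕ) (hk : k = 1 ∨ k = 2) (u v : ℝ) :
    (∀ i < 2 * n + 1,
      eval ![u, v] (P00 (n : ℤ) i) =
        (∑ j ∈ range (2 * n + 2),
          Lent k i j * eval ![u, v] ((if k = 1 then P10 else P01) (n : ℤ) j)) +
        ∑ j ∈ range (2 * n),
          Γ (2 * n) k i j * eval ![u, v] ((if k = 1 then P10 else P01) ((n : ℤ) - 1) j)) ∧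
    (∀ i < 2 * n + 1,
      (if k = 1 then u else v) * eval ![u, v] (P11 ((n : ℤ) - 1) i) =
        (∑ j ∈ range (2 * n + 2),
          Lent k i j * eval ![u, v] ((if k = 1 then P01 else P10) (n : ℤ) j)) +
        ∑ j ∈ range (2 * n),
          Γ (2 * n) k i j * eval ![u, v] ((if k = 1 then P01 else P10) ((n : ℤ) - 1) j)) ∧
    (∀ i < 2 * n + 2,
      eval ![u, v] ((if k = 1 then P01 else P10) (n : ℤ) i) =
        (∑ j ∈ range (2 * n + 3), Lent k i j * eval ![u, v] (P11 (n : ℤ) j)) +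
        ∑ j ∈ range (2 * n + 1),
          Γ (2 * n + 1) k i j * eval ![u, v] (P11 ((n : ℤ) - 1) j)) ∧
    (∀ i < 2 * n + 2,
      (if k = 1 then u else v) * eval ![u, v] ((if k = 1 then P10 else P01) (n : ℤ) i) =
        (∑ j ∈ range (2 * n + 3), Lent k i j * eval ![u, v] (P00 ((n : ℤ) + 1) j)) +
        ∑ j ∈ range (2 * n + 1), Γ (2 * n + 1) k i j * eval ![u, v] (P00 (n : ℤ) j)) := by
  have hOddSum (i : ℕ) (hi : i < 2 * n + 1) (x y : ℝ) :
      (if k = 1 then x else y) * (eval ![x ^ 2, y ^ 2] (P00 n i) +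
          x * y * eval ![x ^ 2, y ^ 2] (P11 (n - 1) i)) =
        x * eval ![x ^ 2, y ^ 2] (rowCombination (2 * n + 2) (2 * n) (Lent k i) (Γ (2 * n) k i)
          (P10 n) (P10 (n - 1))) +
        y * eval ![x ^ 2, y ^ 2] (rowCombination (2 * n + 2) (2 * n) (Lent k i) (Γ (2 * n) k i)
          (P01 n) (P01 (n - 1))) := by
    have hpred : ∀ j ∈ range (2 * n), eval ![x, y] (S (2 * n - 1) j) =
        x * eval ![x ^ 2, y ^ 2] (P10 (n - 1) j) + y * eval ![x ^ 2, y ^ 2] (P01 (n - 1) j) := by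
      intro j hj
      rw [mem_range] at hj
      obtain ⟨m, rfl⟩ : ∃ m, n = m + 1 := ⟨n - 1, by omega⟩
      simpa [mul_add] using hOdd m j (by omega) x y
    rw [← hEven n i hi, hTTR (2 * n) k hk i hi x y,
      sum_mul_eq_of_forall_eq_add fun j hj => hOdd n j (mem_range.1 hj) x y,
      sum_mul_eq_of_forall_eq_add hpred, eval_rowCombination, eval_rowCombination]
    ring
  have hEvenSum (i : ℕ) (hi : i < 2 * n + 2) (x y : ℝ) :
      (if k = 1 then x else y) * (x * eval ![x ^ 2, y ^ 2] (P10 n i) +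
          y * eval ![x ^ 2, y ^ 2] (P01 n i)) =
        eval ![x ^ 2, y ^ 2] (rowCombination (2 * n + 3) (2 * n + 1) (Lent k i)
          (Γ (2 * n + 1) k i) (P00 (n + 1)) (P00 n)) +
        x * y * eval ![x ^ 2, y ^ 2] (rowCombination (2 * n + 3) (2 * n + 1) (Lent k i)
          (Γ (2 * n + 1) k i) (P11 n) (P11 (n - 1))) := by
    have hsucc : ∀ j ∈ range (2 * n + 1 + 2), eval ![x, y] (S (2 * n + 1 + 1) j) =
        1 * eval ![x ^ 2, y ^ 2] (P00 (n + 1) j) + x * y * eval ![x ^ 2, y ^ 2] (P11 n j) := by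
      intro j hj
      rw [mem_range] at hj
      simpa [mul_add] using hEven (n + 1) j (by omega) x y
    have hself : ∀ j ∈ range (2 * n + 1), eval ![x, y] (S (2 * n + 1 - 1) j) =
        1 * eval ![x ^ 2, y ^ 2] (P00 n j) + x * y * eval ![x ^ 2, y ^ 2] (P11 (n - 1) j) := by
      intro j hj
      simpa using hEven n j (mem_range.1 hj) x y
    rw [← hOdd n i hi, hTTR (2 * n + 1) k hk i hi x y, sum_mul_eq_of_forall_eq_add hsucc,
      sum_mul_eq_of_forall_eq_add hself, eval_rowCombination, eval_rowCombination]
    ring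
  simp only [← eval_rowCombination]
  rw [← and_assoc, ← forall₂_and, ← forall₂_and]
  rcases hk with rfl | rfl
  · simp only [if_true] at *
    refine ⟨fun i hi => ?_, fun i hi => ?_⟩
    · obtain ⟨h₁, h₂⟩ := eq_and_eq_of_odd_decomposition (p := P00 n i)
        (q := X 0 * P11 (n - 1) i) fun x y => by
          rw [← hOddSum i hi x y]
          simp
          ring
      simp [← h₁, ← h₂]
    · obtain ⟨h₁, h₂⟩ := eq_and_eq_of_even_decomposition (p := X 0 * P10 n i)
        (q := P01 n i) fun x y => by
          rw [← hEvenSum i hi x y]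
          simp
          ring
      simp [← h₁, ← h₂]
  · simp only [OfNat.ofNat_ne_one, if_false] at *
    refine ⟨fun i hi => ?_, fun i hi => ?_⟩
    · obtain ⟨h₁, h₂⟩ := eq_and_eq_of_odd_decomposition (p := X 1 * P11 (n - 1) i)
        (q := P00 n i) fun x y => by
          rw [← hOddSum i hi x y]
          simp
          ring
      simp [← h₁, ← h₂]
    · obtain ⟨h₁, h₂⟩ := eq_and_eq_of_even_decomposition (p := X 1 * P01 n i)
        (q := P10 n i) fun x y => by
          rw [← hEvenSum i hi x y]
          simp
          ring
      simp [← h₁, ← h₂]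
end
end

section
/- Under the quadratic-decomposition setup, the four 'big' polynomial families satisfy, as identities of vectors of polynomials in (u,v), for all n ≥ 0 and k ∈ {1,2} (writing u₁ = u, u₂ = v, and with vectors of negative index equal to 0): (i) u_k·P^{(0,0)}ₙ = L_{2n,k}L_{2n+1,k} P^{(0,0)}_{n+1} + [L_{2n,k}Γ_{2n+1,k} + Γ_{2n,k}L_{2n−1,k}] P^{(0,0)}ₙ + Γ_{2n,k}Γ_{2n−1,k} P^{(0,0)}_{n−1}; (ii) u_k·P^{(1,1)}_{n−1} = L_{2n,k}L_{2n+1,k} P^{(1,1)}ₙ + [L_{2n,k}Γ_{2n+1,k} + Γ_{2n,k}L_{2n−1,k}] P^{(1,1)}_{n−1} + Γ_{2n,k}Γ_{2n−1,k} P^{(1,1)}_{n−2}; (iii) u_k·P^{(1,0)}ₙ = L_{2n+1,k}L_{2n+2,k} P^{(1,0)}_{n+1} + [L_{2n+1,k}Γ_{2n+2,k} + Γ_{2n+1,k}L_{2n,k}] P^{(1,0)}ₙ + Γ_{2n+1,k}Γ_{2n,k} P^{(1,0)}_{n−1}; (iv) u_k·P^{(0,1)}ₙ = L_{2n+1,k}L_{2n+2,k}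 P^{(0,1)}_{n+1} + [L_{2n+1,k}Γ_{2n+2,k} + Γ_{2n+1,k}L_{2n,k}] P^{(0,1)}ₙ + Γ_{2n+1,k}Γ_{2n,k} P^{(0,1)}_{n−1}. -/
noncomputable section

open MvPolynomial Finset

/-- The defect, in row `i`, of the relation `t f₁ = L_N L_{N+1} f₂ + [L_N Γ_{N+1} + Γ_N L_{N-1}] f₁
+ Γ_N Γ_{N-1} f₀` obtained by applying a three term relation twice. -/
def squareDefect (Γ : ℕ → ℕ → ℕ → ℕ → ℝ) (k N i : ℕ) (t : ℝ) (f₂ f₁ f₀ : ℕ → ℝ) : ℝ :=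
  t * f₁ i -
    ((∑ j ∈ range (N + 3), (∑ m ∈ range (N + 2), Lent k i m * Lent k m j) * f₂ j) +
      (∑ j ∈ range (N + 1),
        ((∑ m ∈ range (N + 2), Lent k i m * Γ (N + 1) k m j) +
          ∑ m ∈ range N, Γ N k i m * Lent k m j) * f₁ j) +
      ∑ j ∈ range (N - 1), (∑ m ∈ range N, Γ N k i m * Γ (N - 1) k m j) * f₀ j)

/-- The polynomial version of `squareDefect`, with `t` the `k`-th variable. -/
def polySquareDefect (Γ : ℕ → ℕ → ℕ → ℕ → ℝ) (k N i : ℕ)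
    (F₂ F₁ F₀ : ℕ → MvPolynomial (Fin 2) ℝ) : MvPolynomial (Fin 2) ℝ :=
  X (if k = 1 then 0 else 1) * F₁ i -
    ((∑ j ∈ range (N + 3), C (∑ m ∈ range (N + 2), Lent k i m * Lent k m j) * F₂ j) +
      (∑ j ∈ range (N + 1),
        C ((∑ m ∈ range (N + 2), Lent k i m * Γ (N + 1) k m j) +
          ∑ m ∈ range N, Γ N k i m * Lent k m j) * F₁ j) +
      ∑ j ∈ range (N - 1), C (∑ m ∈ range N, Γ N k i m * Γ (N - 1) k m j) * F₀ j)

theorem eval_polySquareDefect (Γ : ℕ → ℕ → ℕ → ℕ → ℝ) (k N i : ℕ)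
    (F₂ F₁ F₀ : ℕ → MvPolynomial (Fin 2) ℝ) (u v : ℝ) :
    eval ![u, v] (polySquareDefect Γ k N i F₂ F₁ F₀) =
      squareDefect Γ k N i (if k = 1 then u else v) (fun j => eval ![u, v] (F₂ j))
        (fun j => eval ![u, v] (F₁ j)) (fun j => eval ![u, v] (F₀ j)) := by
  have hX : (![u, v] : Fin 2 → ℝ) (if k = 1 then 0 else 1) = if k = 1 then u else v := by
    split_ifs <;> rfl
  simp only [polySquareDefect, squareDefect, map_sub, map_add, map_mul _ (X _), eval_X, hX,
    map_sum (eval ![u, v]), eval_mul, eval_C]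

theorem squareDefect_eq_of_linear (Γ : ℕ → ℕ → ℕ → ℕ → ℝ) {k N i : ℕ} (hi : i < N + 1)
    (t α β : ℝ) {f₂ f₁ f₀ g₂ g₁ g₀ h₂ h₁ h₀ : ℕ → ℝ}
    (e₂ : ∀ j < N + 3, f₂ j = α * g₂ j + β * h₂ j)
    (e₁ : ∀ j < N + 1, f₁ j = α * g₁ j + β * h₁ j)
    (e₀ : ∀ j < N - 1, f₀ j = α * g₀ j + β * h₀ j) :
    squareDefect Γ k N i t f₂ f₁ f₀ =
      α * squareDefect Γ k N i t g₂ g₁ g₀ + β * squareDefect Γ k N i t h₂ h₁ h₀ := by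
  have sum_linear (M : ℕ) (a f g h : ℕ → ℝ) (e : ∀ j < M, f j = α * g j + β * h j) :
      ∑ j ∈ range M, a j * f j =
        α * ∑ j ∈ range M, a j * g j + β * ∑ j ∈ range M, a j * h j := by
    rw [mul_sum, mul_sum, ← sum_add_distrib]
    refine sum_congr rfl fun j hj => ?_
    rw [e j (mem_range.1 hj)]
    ring
  unfold squareDefect
  rw [e₁ i hi, sum_linear _ _ _ _ _ e₂, sum_linear _ _ _ _ _ e₁, sum_linear _ _ _ _ _ e₀]
  ring

theorem squareDefect_eq_zero (Γ : ℕ → ℕ → ℕ → ℕ → ℝ) {k : ℕ} {t : ℝ} {s : ℕ → ℕ → ℝ}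
    (h : ∀ N, ∀ i < N + 1, t * s N i =
      (∑ j ∈ range (N + 2), Lent k i j * s (N + 1) j) + ∑ j ∈ range N, Γ N k i j * s (N - 1) j)
    {N i : ℕ} (hi : i < N + 1) :
    squareDefect Γ k N i (t ^ 2) (s (N + 2)) (s N) (s (N - 2)) = 0 := by
  have sum_comp (M K : ℕ) (a : ℕ → ℝ) (b : ℕ → ℕ → ℝ) (f : ℕ → ℝ) :
      ∑ m ∈ range M, a m * ∑ j ∈ range K, b m j * f j =
        ∑ j ∈ range K, (∑ m ∈ range M, a m * b m j) * f j := by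
    simp only [mul_sum, sum_mul, mul_assoc]
    exact sum_comm
  have upper : t * ∑ m ∈ range (N + 2), Lent k i m * s (N + 1) m =
      (∑ j ∈ range (N + 3), (∑ m ∈ range (N + 2), Lent k i m * Lent k m j) * s (N + 2) j) +
        ∑ j ∈ range (N + 1), (∑ m ∈ range (N + 2), Lent k i m * Γ (N + 1) k m j) * s N j := by
    rw [← sum_comp, ← sum_comp, ← sum_add_distrib, mul_sum]
    refine sum_congr rfl fun m hm => ?_
    rw [mul_left_comm, h (N + 1) m (mem_range.1 hm), mul_add]
    rfl
  have lower : t * ∑ m ∈ range N, Γ N k i m * s (N - 1) m =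
      (∑ j ∈ range (N + 1), (∑ m ∈ range N, Γ N k i m * Lent k m j) * s N j) +
        ∑ j ∈ range (N - 1), (∑ m ∈ range N, Γ N k i m * Γ (N - 1) k m j) * s (N - 2) j := by
    rw [← sum_comp, ← sum_comp, ← sum_add_distrib, mul_sum]
    refine sum_congr rfl fun m hm => ?_
    obtain _ | M := N
    · simp at hm
    · rw [mul_left_comm, h (M + 1 - 1) m (mem_range.1 hm), mul_add]
      rfl
  unfold squareDefect
  simp only [add_mul, sum_add_distrib]
  linear_combination t * h N i hi + upper + lower

theorem eq_zero_of_eval_pos {A : MvPolynomial (Fin 2) ℝ}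
    (h : ∀ x y : ℝ, 0 < x → 0 < y → eval ![x ^ 2, y ^ 2] A = 0) : A = 0 := by
  refine MvPolynomial.funext_set (fun _ => Set.Ioi (0 : ℝ)) (fun _ => Set.Ioi_infinite 0) ?_
  intro z hz
  have hpos (i : Fin 2) : 0 < z i := hz i (Set.mem_univ i)
  have e : z = ![√(z 0) ^ 2, √(z 1) ^ 2] := by
    ext i
    fin_cases i <;> simp [Real.sq_sqrt (hpos _).le]
  rw [e, h _ _ (Real.sqrt_pos.2 (hpos 0)) (Real.sqrt_pos.2 (hpos 1)), map_zero]

theorem eq_zero_and_eq_zero_of_even {A B : MvPolynomial (Fin 2) ℝ}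
    (h : ∀ x y : ℝ, eval ![x ^ 2, y ^ 2] A + x * y * eval ![x ^ 2, y ^ 2] B = 0) :
    A = 0 ∧ B = 0 := by
  constructor <;> refine eq_zero_of_eval_pos fun x y hx hy => ?_ <;>
    have h₁ := h x y <;> have h₂ := h x (-y) <;> rw [neg_sq] at h₂
  · linarith
  · have : x * y * eval ![x ^ 2, y ^ 2] B = 0 := by linarith
    exact (mul_eq_zero.1 this).resolve_left (by positivity)

theorem eq_zero_and_eq_zero_of_odd {A B : MvPolynomial (Fin 2) ℝ}
    (h : ∀ x y : ℝ, x * eval ![x ^ 2, y ^ 2] A + y * eval ![x ^ 2, y ^ 2] B = 0) :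
    A = 0 ∧ B = 0 := by
  constructor <;> refine eq_zero_of_eval_pos fun x y hx hy => ?_ <;>
    have h₁ := h x y <;> have h₂ := h x (-y) <;> rw [neg_sq] at h₂
  · have : x * eval ![x ^ 2, y ^ 2] A = 0 := by linarith
    exact (mul_eq_zero.1 this).resolve_left hx.ne'
  · have : y * eval ![x ^ 2, y ^ 2] B = 0 := by linarith
    exact (mul_eq_zero.1 this).resolve_left hy.ne'

/-- Three term relations for the four 'big' families of the quadratic decomposition
(Lemma `TTR_BigPoly`): for all `n ≥ 0`, `k ∈ {1,2}` (with `u₁ = u`, `u₂ = v`, vectors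
of negative index being `0`), e.g.
`u_k P⁽⁰'⁰⁾ₙ = L_{2n,k} L_{2n+1,k} P⁽⁰'⁰⁾_{n+1}
  + [L_{2n,k} Γ_{2n+1,k} + Γ_{2n,k} L_{2n-1,k}] P⁽⁰'⁰⁾ₙ
  + Γ_{2n,k} Γ_{2n-1,k} P⁽⁰'⁰⁾_{n-1}`,
and similarly for `P⁽¹'¹⁾`, `P⁽¹'⁰⁾`, `P⁽⁰'¹⁾`, stated entrywise via evaluation. -/
theorem stmt13
    (Γ : ℕ → ℕ → ℕ → ℕ → ℝ)
    (S : ℕ → ℕ → MvPolynomial (Fin 2) ℝ)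
    (P00 P11 P10 P01 : ℤ → ℕ → MvPolynomial (Fin 2) ℝ)
    (hneg : ∀ m : ℤ, m < 0 → ∀ i : ℕ,
      P00 m i = 0 ∧ P11 m i = 0 ∧ P10 m i = 0 ∧ P01 m i = 0)
    (hTTR : ∀ (N k : ℕ), k = 1 ∨ k = 2 → ∀ i < N + 1, ∀ x y : ℝ,
      (if k = 1 then x else y) * eval ![x, y] (S N i) =
        (∑ j ∈ range (N + 2), Lent k i j * eval ![x, y] (S (N + 1) j)) +
        ∑ j ∈ range N, Γ N k i j * eval ![x, y] (S (N - 1) j))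
    (hEven : ∀ (N : ℕ), ∀ i < 2 * N + 1, ∀ x y : ℝ,
      eval ![x, y] (S (2 * N) i) =
        eval ![x ^ 2, y ^ 2] (P00 (N : ℤ) i) +
          x * y * eval ![x ^ 2, y ^ 2] (P11 ((N : ℤ) - 1) i))
    (hOdd : ∀ (N : ℕ), ∀ i < 2 * N + 2, ∀ x y : ℝ,
      eval ![x, y] (S (2 * N + 1) i) =
        x * eval ![x ^ 2, y ^ 2] (P10 (N : ℤ) i) +
          y * eval ![x ^ 2, y ^ 2] (P01 (N : ℤ) i))
    (n k : ℕ) (hk : k = 1 ∨ k = 2) (u v : ℝ) :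
    (∀ i < 2 * n + 1,
      (if k = 1 then u else v) * eval ![u, v] (P00 (n : ℤ) i) =
        (∑ j ∈ range (2 * n + 3),
          (∑ m ∈ range (2 * n + 2), Lent k i m * Lent k m j) *
            eval ![u, v] (P00 ((n : ℤ) + 1) j)) +
        (∑ j ∈ range (2 * n + 1),
          ((∑ m ∈ range (2 * n + 2), Lent k i m * Γ (2 * n + 1) k m j) +
            ∑ m ∈ range (2 * n), Γ (2 * n) k i m * Lent k m j) *
            eval ![u, v] (P00 (n : ℤ) j)) +
        ∑ j ∈ range (2 * n - 1),
          (∑ m ∈ range (2 * n), Γ (2 * n) k i m * Γ (2 * n - 1) k m j) *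
            eval ![u, v] (P00 ((n : ℤ) - 1) j)) ∧
    (∀ i < 2 * n + 1,
      (if k = 1 then u else v) * eval ![u, v] (P11 ((n : ℤ) - 1) i) =
        (∑ j ∈ range (2 * n + 3),
          (∑ m ∈ range (2 * n + 2), Lent k i m * Lent k m j) *
            eval ![u, v] (P11 (n : ℤ) j)) +
        (∑ j ∈ range (2 * n + 1),
          ((∑ m ∈ range (2 * n + 2), Lent k i m * Γ (2 * n + 1) k m j) +
            ∑ m ∈ range (2 * n), Γ (2 * n) k i m * Lent k m j) *
            eval ![u, v] (P11 ((n : ℤ) - 1) j)) +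
        ∑ j ∈ range (2 * n - 1),
          (∑ m ∈ range (2 * n), Γ (2 * n) k i m * Γ (2 * n - 1) k m j) *
            eval ![u, v] (P11 ((n : ℤ) - 2) j)) ∧
    (∀ i < 2 * n + 2,
      (if k = 1 then u else v) * eval ![u, v] (P10 (n : ℤ) i) =
        (∑ j ∈ range (2 * n + 4),
          (∑ m ∈ range (2 * n + 3), Lent k i m * Lent k m j) *
            eval ![u, v] (P10 ((n : ℤ) + 1) j)) +
        (∑ j ∈ range (2 * n + 2),
          ((∑ m ∈ range (2 * n + 3), Lent k i m * Γ (2 * n + 2) k m j) +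
            ∑ m ∈ range (2 * n + 1), Γ (2 * n + 1) k i m * Lent k m j) *
            eval ![u, v] (P10 (n : ℤ) j)) +
        ∑ j ∈ range (2 * n),
          (∑ m ∈ range (2 * n + 1), Γ (2 * n + 1) k i m * Γ (2 * n) k m j) *
            eval ![u, v] (P10 ((n : ℤ) - 1) j)) ∧
    (∀ i < 2 * n + 2,
      (if k = 1 then u else v) * eval ![u, v] (P01 (n : ℤ) i) =
        (∑ j ∈ range (2 * n + 4),
          (∑ m ∈ range (2 * n + 3), Lent k i m * Lent k m j) *
            eval ![u, v] (P01 ((n : ℤ) + 1) j)) +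
        (∑ j ∈ range (2 * n + 2),
          ((∑ m ∈ range (2 * n + 3), Lent k i m * Γ (2 * n + 2) k m j) +
            ∑ m ∈ range (2 * n + 1), Γ (2 * n + 1) k i m * Lent k m j) *
            eval ![u, v] (P01 (n : ℤ) j)) +
        ∑ j ∈ range (2 * n),
          (∑ m ∈ range (2 * n + 1), Γ (2 * n + 1) k i m * Γ (2 * n) k m j) *
            eval ![u, v] (P01 ((n : ℤ) - 1) j)) := by
  have zero (x y : ℝ) {N i : ℕ} (hi : i < N + 1) :
      squareDefect Γ k N i (if k = 1 then x ^ 2 else y ^ 2) (fun j => eval ![x, y] (S (N + 2) j))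
        (fun j => eval ![x, y] (S N j)) (fun j => eval ![x, y] (S (N - 2) j)) = 0 := by
    rw [← ite_pow]
    exact squareDefect_eq_zero Γ (s := fun N j => eval ![x, y] (S N j))
      (fun N i hi => hTTR N k hk i hi x y) hi
  have even (i : ℕ) (hi : i < 2 * n + 1) :
      polySquareDefect Γ k (2 * n) i (P00 ((n : ℤ) + 1)) (P00 n) (P00 ((n : ℤ) - 1)) = 0 ∧
      polySquareDefect Γ k (2 * n) i (P11 n) (P11 ((n : ℤ) - 1)) (P11 ((n : ℤ) - 2)) = 0 := by
    refine eq_zero_and_eq_zero_of_even fun x y => ?_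
    rw [← one_mul (eval _ (polySquareDefect _ _ _ _ (P00 _) _ _)), eval_polySquareDefect,
      eval_polySquareDefect]
    refine (squareDefect_eq_of_linear Γ hi _ 1 (x * y) ?_ ?_ ?_).symm.trans (zero x y hi)
    · intro j hj
      simpa [mul_add] using hEven (n + 1) j (by omega) x y
    · intro j hj
      simpa using hEven n j hj x y
    · intro j hj
      obtain ⟨m, rfl⟩ : ∃ m, n = m + 1 := ⟨n - 1, by omega⟩
      have e : ((m + 1 : ℕ) : ℤ) - 2 = m - 1 := by push_cast; ring
      rw [e]
      simpa [mul_add] using hEven m j (by omega) x y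
  have odd (i : ℕ) (hi : i < 2 * n + 2) :
      polySquareDefect Γ k (2 * n + 1) i (P10 ((n : ℤ) + 1)) (P10 n) (P10 ((n : ℤ) - 1)) = 0 ∧
      polySquareDefect Γ k (2 * n + 1) i (P01 ((n : ℤ) + 1)) (P01 n) (P01 ((n : ℤ) - 1)) = 0 := by
    refine eq_zero_and_eq_zero_of_odd fun x y => ?_
    rw [eval_polySquareDefect, eval_polySquareDefect]
    refine (squareDefect_eq_of_linear Γ hi _ x y ?_ ?_ ?_).symm.trans (zero x y hi)
    · intro j hj
      simpa [mul_add] using hOdd (n + 1) j (by omega) x y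
    · intro j hj
      exact hOdd n j hj x y
    · intro j hj
      obtain ⟨m, rfl⟩ : ∃ m, n = m + 1 := ⟨n - 1, by omega⟩
      simpa [mul_add] using hOdd m j (by omega) x y
  have relation {N i : ℕ} {F₂ F₁ F₀ : ℕ → MvPolynomial (Fin 2) ℝ}
      (h : polySquareDefect Γ k N i F₂ F₁ F₀ = 0) :
      squareDefect Γ k N i (if k = 1 then u else v) (fun j => eval ![u, v] (F₂ j))
        (fun j => eval ![u, v] (F₁ j)) (fun j => eval ![u, v] (F₀ j)) = 0 := by
    rw [← eval_polySquareDefect, h, map_zero]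
  exact ⟨fun i hi => sub_eq_zero.1 (relation (even i hi).1),
    fun i hi => sub_eq_zero.1 (relation (even i hi).2),
    fun i hi => sub_eq_zero.1 (relation (odd i hi).1),
    fun i hi => sub_eq_zero.1 (relation (odd i hi).2)⟩
end
end

section
/- Under the quadratic-decomposition setup, assume in addition the zero patterns (0-indexed entries): the odd-position entries of each P^{(0,0)}ₙ and each P^{(1,0)}ₙ vanish, and the even-position entries of each P^{(1,1)}ₙ and each P^{(0,1)}ₙ vanish. Define the 'small' vectors P̂ₙ^{(i,j)} = J_n^{(i,j)} P^{(i,j)}ₙ for i,j ∈ {0,1}. Then for all n ≥ 0 and k ∈ {1,2} (u₁ = u, u₂ = v, vectors of negative index are 0): (i) u_k·P̂^{(0,0)}ₙ = L_{n,k} P̂^{(0,0)}_{n+1} + J_n^{(0,0)}[L_{2n,k}Γ_{2n+1,k} + Γ_{2n,k}L_{2n−1,k}](J_n^{(0,0)})ᵀ P̂^{(0,0)}ₙ + J_n^{(0,0)}Γ_{2n,k}Γ_{2n−1,k}(J_{n−1}^{(0,0)})ᵀ P̂^{(0,0)}_{n−1}; (ii) u_k·P̂^{(1,1)}_{n−1}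 = L_{n−1,k} P̂^{(1,1)}ₙ + J_{n−1}^{(1,1)}[L_{2n,k}Γ_{2n+1,k} + Γ_{2n,k}L_{2n−1,k}](J_{n−1}^{(1,1)})ᵀ P̂^{(1,1)}_{n−1} + J_{n−1}^{(1,1)}Γ_{2n,k}Γ_{2n−1,k}(J_{n−2}^{(1,1)})ᵀ P̂^{(1,1)}_{n−2}; (iii) u_k·P̂^{(1,0)}ₙ = L_{n,k} P̂^{(1,0)}_{n+1} + J_n^{(1,0)}[L_{2n+1,k}Γ_{2n+2,k} + Γ_{2n+1,k}L_{2n,k}](J_n^{(1,0)})ᵀ P̂^{(1,0)}ₙ + J_n^{(1,0)}Γ_{2n+1,k}Γ_{2n,k}(J_{n−1}^{(1,0)})ᵀ P̂^{(1,0)}_{n−1}; (iv) u_k·P̂^{(0,1)}ₙ = L_{n,k} P̂^{(0,1)}_{n+1} + J_n^{(0,1)}[L_{2n+1,k}Γ_{2n+2,k} + Γ_{2n+1,k}L_{2n,k}](J_n^{(0,1)})ᵀ P̂^{(0,1)}ₙ + J_n^{(0,1)}Γ_{2n+1,k}Γ_{2n,k}(J_{n−1}^{(0,1)})ᵀ P̂^{(0,1)}_{n−1}.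 -/
noncomputable section

open MvPolynomial Finset

/-- Entry `(i, b)` of `L_{N,k} Γ_{N+1,k} + Γ_{N,k} L_{N-1,k}`. -/
def midCoeff (Γ : ℕ → ℕ → ℕ → ℕ → ℝ) (N k i b : ℕ) : ℝ :=
  (∑ m ∈ range (N + 2), Lent k i m * Γ (N + 1) k m b) + ∑ m ∈ range N, Γ N k i m * Lent k m b

/-- Entry `(i, b)` of `Γ_{N,k} Γ_{N-1,k}`. -/
def lowCoeff (Γ : ℕ → ℕ → ℕ → ℕ → ℝ) (N k i b : ℕ) : ℝ :=
  ∑ m ∈ range N, Γ N k i m * Γ (N - 1) k m b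

theorem sum_Lent_mul {k h M : ℕ} (hM : h + (k - 1) < M) (f : ℕ → ℝ) :
    ∑ m ∈ range M, Lent k h m * f m = f (h + (k - 1)) := by
  simp [Lent, hM]

theorem sum_Jent_mul_mul_Jent {s i j A B : ℕ} (hA : 2 * i + s < A) (hB : 2 * j + s < B)
    (F : ℕ → ℕ → ℝ) :
    ∑ a ∈ range A, ∑ b ∈ range B, Jent s i a * F a b * Jent s j b =
      F (2 * i + s) (2 * j + s) := by
  simp [Jent, hA, hB]

/-- A sum whose terms vanish off the residue class of `s` modulo `2`. -/
theorem sum_range_eq_sum_two_mul_add {s B M : ℕ} (hBM : ∀ j, 2 * j + s < B ↔ j < M)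
    (f : ℕ → ℝ) (hf : ∀ b, b % 2 ≠ s → f b = 0) :
    ∑ b ∈ range B, f b = ∑ j ∈ range M, f (2 * j + s) := by
  symm
  apply Finset.sum_of_injOn (fun j => 2 * j + s)
  · intro a _ b _ h
    simpa using h
  · intro j hj
    simpa [hBM] using hj
  · intro b hb hb'
    apply hf
    intro h
    apply hb'
    have hbs : 2 * (b / 2) + s = b := by omega
    refine ⟨b / 2, ?_, hbs⟩
    have := (hBM (b / 2)).1 (by rw [hbs]; simpa using hb)
    simpa using this
  · intro j _
    rfl

/-- Applying the three term relation of `S` twice. -/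
theorem sq_mul_eq_of_three_term {Γ : ℕ → ℕ → ℕ → ℕ → ℝ} {k : ℕ} (hk : k = 1 ∨ k = 2)
    {t : ℝ} {s : ℕ → ℕ → ℝ}
    (h : ∀ N, ∀ i < N + 1, t * s N i = (∑ j ∈ range (N + 2), Lent k i j * s (N + 1) j) +
      ∑ j ∈ range N, Γ N k i j * s (N - 1) j)
    (N i : ℕ) (hi : i < N + 1) :
    t ^ 2 * s N i = s (N + 2) (i + 2 * (k - 1)) +
      (∑ b ∈ range (N + 1), midCoeff Γ N k i b * s N b) +
      ∑ b ∈ range (N - 1), lowCoeff Γ N k i b * s (N - 2) b := by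
  have h1 : t * s (N + 1) (i + (k - 1)) = s (N + 2) (i + 2 * (k - 1)) +
      ∑ b ∈ range (N + 1), Γ (N + 1) k (i + (k - 1)) b * s N b := by
    rw [h (N + 1) _ (by omega), sum_Lent_mul (by omega), Nat.add_sub_cancel]
    rw [two_mul, ← add_assoc i]
  have h2 : ∀ m ∈ range N, t * (Γ N k i m * s (N - 1) m) =
      (∑ b ∈ range (N + 1), Γ N k i m * Lent k m b * s N b) +
        ∑ b ∈ range (N - 1), Γ N k i m * Γ (N - 1) k m b * s (N - 2) b := by
    intro m hm
    obtain ⟨M, rfl⟩ : ∃ M, N = M + 1 := ⟨N - 1, by have := mem_range.1 hm; omega⟩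
    have := h M m (mem_range.1 hm)
    simp only [Nat.add_sub_cancel, mul_assoc, ← mul_sum] at this ⊢
    rw [mul_left_comm, this, mul_add]
    rfl
  have h3 := h N i hi
  rw [sum_Lent_mul (by omega)] at h3
  rw [sq, mul_assoc, h3, mul_add, h1, mul_sum, sum_congr rfl h2, sum_add_distrib,
    sum_comm (s := range N), sum_comm (s := range N)]
  simp only [midCoeff, lowCoeff, add_mul, sum_add_distrib, sum_mul]
  simp only [← sum_mul, sum_Lent_mul (show i + (k - 1) < N + 2 by omega)]
  ring

theorem MvPolynomial.eq_zero_of_eval_sq_eq_zero {p : MvPolynomial (Fin 2) ℝ}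
    (h : ∀ x y : ℝ, 0 < x → 0 < y → eval ![x ^ 2, y ^ 2] p = 0) : p = 0 := by
  refine MvPolynomial.funext_set (fun _ => Set.Ioi (0 : ℝ)) (fun _ => Set.Ioi_infinite 0) ?_
  intro z hz
  have hz0 : 0 < z 0 := hz 0 (Set.mem_univ _)
  have hz1 : 0 < z 1 := hz 1 (Set.mem_univ _)
  have := h _ _ (Real.sqrt_pos.2 hz0) (Real.sqrt_pos.2 hz1)
  rw [Real.sq_sqrt hz0.le, Real.sq_sqrt hz1.le] at this
  rw [map_zero, ← this]
  congr 1
  congr 1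
  ext i
  fin_cases i <;> rfl

theorem eq_zero_of_eval_sq_add_mul_eval_sq {p q : MvPolynomial (Fin 2) ℝ}
    (h : ∀ x y : ℝ, eval ![x ^ 2, y ^ 2] p + x * y * eval ![x ^ 2, y ^ 2] q = 0) :
    p = 0 ∧ q = 0 := by
  refine ⟨MvPolynomial.eq_zero_of_eval_sq_eq_zero fun x y _ _ => ?_,
    MvPolynomial.eq_zero_of_eval_sq_eq_zero fun x y hx hy => ?_⟩ <;>
    have h1 := h x y <;> have h2 := h (-x) y <;> rw [neg_sq] at h2
  · linarith
  · exact (mul_eq_zero.1 (show x * y * _ = 0 by linarith)).resolve_left (by positivity)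

theorem eq_zero_of_mul_eval_sq_add_mul_eval_sq {p q : MvPolynomial (Fin 2) ℝ}
    (h : ∀ x y : ℝ, x * eval ![x ^ 2, y ^ 2] p + y * eval ![x ^ 2, y ^ 2] q = 0) :
    p = 0 ∧ q = 0 := by
  refine ⟨MvPolynomial.eq_zero_of_eval_sq_eq_zero fun x y hx _ => ?_,
    MvPolynomial.eq_zero_of_eval_sq_eq_zero fun x y _ hy => ?_⟩ <;>
    have h1 := h x y <;> have h2 := h (-x) y <;> rw [neg_sq] at h2
  · exact (mul_eq_zero.1 (show x * _ = 0 by linarith)).resolve_left hx.ne'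
  · exact (mul_eq_zero.1 (show y * _ = 0 by linarith)).resolve_left hy.ne'

/-- The defect of the three term relation, as a polynomial, for a family with coefficients
`c` and `d`. -/
def defect (k A B : ℕ) (c d : ℕ → ℝ) (q p : MvPolynomial (Fin 2) ℝ)
    (f g : ℕ → MvPolynomial (Fin 2) ℝ) : MvPolynomial (Fin 2) ℝ :=
  (if k = 1 then X 0 else X 1) * q - p - (∑ b ∈ range A, C (c b) * f b) -
    ∑ b ∈ range B, C (d b) * g b

theorem eval_defect (k A B : ℕ) (c d : ℕ → ℝ) (q p : MvPolynomial (Fin 2) ℝ)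
    (f g : ℕ → MvPolynomial (Fin 2) ℝ) (u v : ℝ) :
    eval ![u, v] (defect k A B c d q p f g) =
      (if k = 1 then u else v) * eval ![u, v] q - eval ![u, v] p -
        (∑ b ∈ range A, c b * eval ![u, v] (f b)) - ∑ b ∈ range B, d b * eval ![u, v] (g b) := by
  simp only [defect, map_sub, map_mul, map_sum, eval_C]
  split_ifs <;> simp

/-- Passage from the full relation to the relation compressed to the residue class of `s`. -/
theorem three_term_compress {k s i A B M M₀ M₁ : ℕ}
    (hA : ∀ j, 2 * j + s < A ↔ j < M) (hB : ∀ j, 2 * j + s < B ↔ j < M₀)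
    (hi : i < M) (hM₁ : i + (k - 1) < M₁) {c d : ℕ → ℕ → ℝ}
    {p f g : ℕ → MvPolynomial (Fin 2) ℝ}
    (hf : ∀ b, b % 2 ≠ s → f b = 0) (hg : ∀ b, b % 2 ≠ s → g b = 0)
    (h : defect k A B (c (2 * i + s)) (d (2 * i + s)) (f (2 * i + s))
      (p (2 * i + s + 2 * (k - 1))) f g = 0) (u v : ℝ) :
    (if k = 1 then u else v) * eval ![u, v] (f (2 * i + s)) =
      (∑ j ∈ range M₁, Lent k i j * eval ![u, v] (p (2 * j + s))) +
      (∑ j ∈ range M, (∑ a ∈ range A, ∑ b ∈ range A, Jent s i a * c a b * Jent s j b) *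
        eval ![u, v] (f (2 * j + s))) +
      ∑ j ∈ range M₀, (∑ a ∈ range A, ∑ b ∈ range B, Jent s i a * d a b * Jent s j b) *
        eval ![u, v] (g (2 * j + s)) := by
  have h0 := congrArg (eval ![u, v]) h
  rw [eval_defect, map_zero, sum_range_eq_sum_two_mul_add hA _ (fun b hb => by simp [hf b hb]),
    sum_range_eq_sum_two_mul_add hB _ (fun b hb => by simp [hg b hb])] at h0
  rw [sum_Lent_mul hM₁]
  have h1 : ∀ j ∈ range M, (∑ a ∈ range A, ∑ b ∈ range A, Jent s i a * c a b * Jent s j b) *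
      eval ![u, v] (f (2 * j + s)) = c (2 * i + s) (2 * j + s) * eval ![u, v] (f (2 * j + s)) :=
    fun j hj => by rw [sum_Jent_mul_mul_Jent ((hA i).2 hi) ((hA j).2 (mem_range.1 hj))]
  have h2 : ∀ j ∈ range M₀, (∑ a ∈ range A, ∑ b ∈ range B, Jent s i a * d a b * Jent s j b) *
      eval ![u, v] (g (2 * j + s)) = d (2 * i + s) (2 * j + s) * eval ![u, v] (g (2 * j + s)) :=
    fun j hj => by rw [sum_Jent_mul_mul_Jent ((hA i).2 hi) ((hB j).2 (mem_range.1 hj))]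
  rw [sum_congr rfl h1, sum_congr rfl h2,
    show 2 * (i + (k - 1)) + s = 2 * i + s + 2 * (k - 1) by ring]
  linarith

/-- Three term relations for the four 'small' families
`P̂ₙ^(i,j) = J_n^(i,j) P^(i,j)ₙ` of the quadratic decomposition: for all `n ≥ 0` and
`k ∈ {1,2}` (with `u₁ = u`, `u₂ = v`, vectors of negative index being `0`), e.g.
`u_k P̂⁽⁰'⁰⁾ₙ = L_{n,k} P̂⁽⁰'⁰⁾_{n+1}
  + J_n⁽⁰'⁰⁾ [L_{2n,k} Γ_{2n+1,k} + Γ_{2n,k} L_{2n-1,k}] (J_n⁽⁰'⁰⁾)ᵀ P̂⁽⁰'⁰⁾ₙ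
  + J_n⁽⁰'⁰⁾ Γ_{2n,k} Γ_{2n-1,k} (J_{n-1}⁽⁰'⁰⁾)ᵀ P̂⁽⁰'⁰⁾_{n-1}`,
and similarly for `P̂⁽¹'¹⁾`, `P̂⁽¹'⁰⁾`, `P̂⁽⁰'¹⁾`, stated entrywise via evaluation
(the entries of `P̂⁽⁰'⁰⁾ₙ`, `P̂⁽¹'⁰⁾ₙ` are the even-position entries of `P⁽⁰'⁰⁾ₙ`,
`P⁽¹'⁰⁾ₙ`, and the entries of `P̂⁽¹'¹⁾ₙ`, `P̂⁽⁰'¹⁾ₙ` are the odd-position entries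
of `P⁽¹'¹⁾ₙ`, `P⁽⁰'¹⁾ₙ`). -/
theorem stmt14
    (Γ : ℕ → ℕ → ℕ → ℕ → ℝ)
    (S : ℕ → ℕ → MvPolynomial (Fin 2) ℝ)
    (P00 P11 P10 P01 : ℤ → ℕ → MvPolynomial (Fin 2) ℝ)
    (hneg : ∀ m : ℤ, m < 0 → ∀ i : ℕ,
      P00 m i = 0 ∧ P11 m i = 0 ∧ P10 m i = 0 ∧ P01 m i = 0)
    (hTTR : ∀ (N k : ℕ), k = 1 ∨ k = 2 → ∀ i < N + 1, ∀ x y : ℝ,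
      (if k = 1 then x else y) * eval ![x, y] (S N i) =
        (∑ j ∈ range (N + 2), Lent k i j * eval ![x, y] (S (N + 1) j)) +
        ∑ j ∈ range N, Γ N k i j * eval ![x, y] (S (N - 1) j))
    (hEven : ∀ (N : ℕ), ∀ i < 2 * N + 1, ∀ x y : ℝ,
      eval ![x, y] (S (2 * N) i) =
        eval ![x ^ 2, y ^ 2] (P00 (N : ℤ) i) +
          x * y * eval ![x ^ 2, y ^ 2] (P11 ((N : ℤ) - 1) i))
    (hOdd : ∀ (N : ℕ), ∀ i < 2 * N + 2, ∀ x y : ℝ,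
      eval ![x, y] (S (2 * N + 1) i) =
        x * eval ![x ^ 2, y ^ 2] (P10 (N : ℤ) i) +
          y * eval ![x ^ 2, y ^ 2] (P01 (N : ℤ) i))
    (hzero : ∀ (m : ℤ) (i : ℕ),
      (Odd i → P00 m i = 0 ∧ P10 m i = 0) ∧ (Even i → P11 m i = 0 ∧ P01 m i = 0))
    (n k : ℕ) (hk : k = 1 ∨ k = 2) (u v : ℝ) :
    (∀ i < n + 1,
      (if k = 1 then u else v) * eval ![u, v] (P00 (n : ℤ) (2 * i)) =
        (∑ j ∈ range (n + 2), Lent k i j * eval ![u, v] (P00 ((n : ℤ) + 1) (2 * j))) +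
        (∑ j ∈ range (n + 1),
          (∑ a ∈ range (2 * n + 1), ∑ b ∈ range (2 * n + 1),
            Jent 0 i a *
              ((∑ m ∈ range (2 * n + 2), Lent k a m * Γ (2 * n + 1) k m b) +
                ∑ m ∈ range (2 * n), Γ (2 * n) k a m * Lent k m b) * Jent 0 j b) *
            eval ![u, v] (P00 (n : ℤ) (2 * j))) +
        ∑ j ∈ range n,
          (∑ a ∈ range (2 * n + 1), ∑ b ∈ range (2 * n - 1),
            Jent 0 i a *
              (∑ m ∈ range (2 * n), Γ (2 * n) k a m * Γ (2 * n - 1) k m b) * Jent 0 j b) *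
            eval ![u, v] (P00 ((n : ℤ) - 1) (2 * j))) ∧
    (∀ i < n,
      (if k = 1 then u else v) * eval ![u, v] (P11 ((n : ℤ) - 1) (2 * i + 1)) =
        (∑ j ∈ range (n + 1), Lent k i j * eval ![u, v] (P11 (n : ℤ) (2 * j + 1))) +
        (∑ j ∈ range n,
          (∑ a ∈ range (2 * n + 1), ∑ b ∈ range (2 * n + 1),
            Jent 1 i a *
              ((∑ m ∈ range (2 * n + 2), Lent k a m * Γ (2 * n + 1) k m b) +
                ∑ m ∈ range (2 * n), Γ (2 * n) k a m * Lent k m b) * Jent 1 j b) *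
            eval ![u, v] (P11 ((n : ℤ) - 1) (2 * j + 1))) +
        ∑ j ∈ range (n - 1),
          (∑ a ∈ range (2 * n + 1), ∑ b ∈ range (2 * n - 1),
            Jent 1 i a *
              (∑ m ∈ range (2 * n), Γ (2 * n) k a m * Γ (2 * n - 1) k m b) * Jent 1 j b) *
            eval ![u, v] (P11 ((n : ℤ) - 2) (2 * j + 1))) ∧
    (∀ i < n + 1,
      (if k = 1 then u else v) * eval ![u, v] (P10 (n : ℤ) (2 * i)) =
        (∑ j ∈ range (n + 2), Lent k i j * eval ![u, v] (P10 ((n : ℤ) + 1) (2 * j))) +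
        (∑ j ∈ range (n + 1),
          (∑ a ∈ range (2 * n + 2), ∑ b ∈ range (2 * n + 2),
            Jent 0 i a *
              ((∑ m ∈ range (2 * n + 3), Lent k a m * Γ (2 * n + 2) k m b) +
                ∑ m ∈ range (2 * n + 1), Γ (2 * n + 1) k a m * Lent k m b) * Jent 0 j b) *
            eval ![u, v] (P10 (n : ℤ) (2 * j))) +
        ∑ j ∈ range n,
          (∑ a ∈ range (2 * n + 2), ∑ b ∈ range (2 * n),
            Jent 0 i a *
              (∑ m ∈ range (2 * n + 1), Γ (2 * n + 1) k a m * Γ (2 * n) k m b) *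
                Jent 0 j b) *
            eval ![u, v] (P10 ((n : ℤ) - 1) (2 * j))) ∧
    (∀ i < n + 1,
      (if k = 1 then u else v) * eval ![u, v] (P01 (n : ℤ) (2 * i + 1)) =
        (∑ j ∈ range (n + 2), Lent k i j * eval ![u, v] (P01 ((n : ℤ) + 1) (2 * j + 1))) +
        (∑ j ∈ range (n + 1),
          (∑ a ∈ range (2 * n + 2), ∑ b ∈ range (2 * n + 2),
            Jent 1 i a *
              ((∑ m ∈ range (2 * n + 3), Lent k a m * Γ (2 * n + 2) k m b) +
                ∑ m ∈ range (2 * n + 1), Γ (2 * n + 1) k a m * Lent k m b) * Jent 1 j b) *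
            eval ![u, v] (P01 (n : ℤ) (2 * j + 1))) +
        ∑ j ∈ range n,
          (∑ a ∈ range (2 * n + 2), ∑ b ∈ range (2 * n),
            Jent 1 i a *
              (∑ m ∈ range (2 * n + 1), Γ (2 * n + 1) k a m * Γ (2 * n) k m b) *
                Jent 1 j b) *
            eval ![u, v] (P01 ((n : ℤ) - 1) (2 * j + 1))) := by
  have hsq : ∀ (N i : ℕ), i < N + 1 → ∀ x y : ℝ,
      (if k = 1 then x ^ 2 else y ^ 2) * eval ![x, y] (S N i) =
        eval ![x, y] (S (N + 2) (i + 2 * (k - 1))) +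
        (∑ b ∈ range (N + 1), midCoeff Γ N k i b * eval ![x, y] (S N b)) +
        ∑ b ∈ range (N - 1), lowCoeff Γ N k i b * eval ![x, y] (S (N - 2) b) := by
    intro N i hi x y
    have := sq_mul_eq_of_three_term hk (s := fun N i => eval ![x, y] (S N i))
      (fun N i hi => hTTR N k hk i hi x y) N i hi
    rwa [ite_pow] at this
  have hE : ∀ i < 2 * n + 1,
      defect k (2 * n + 1) (2 * n - 1) (midCoeff Γ (2 * n) k i) (lowCoeff Γ (2 * n) k i)
        (P00 n i) (P00 (n + 1) (i + 2 * (k - 1))) (P00 n) (P00 (n - 1)) = 0 ∧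
      defect k (2 * n + 1) (2 * n - 1) (midCoeff Γ (2 * n) k i) (lowCoeff Γ (2 * n) k i)
        (P11 (n - 1) i) (P11 n (i + 2 * (k - 1))) (P11 (n - 1)) (P11 (n - 2)) = 0 := by
    intro i hi
    apply eq_zero_of_eval_sq_add_mul_eval_sq
    intro x y
    have h := hsq (2 * n) i hi x y
    have h2 := hEven (n + 1) (i + 2 * (k - 1)) (by omega) x y
    push_cast at h2
    rw [add_sub_cancel_right] at h2
    have hlow : ∀ b ∈ range (2 * n - 1), lowCoeff Γ (2 * n) k i b *
        eval ![x, y] (S (2 * n - 2) b) = lowCoeff Γ (2 * n) k i b *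
          (eval ![x ^ 2, y ^ 2] (P00 ((n : ℤ) - 1) b) +
            x * y * eval ![x ^ 2, y ^ 2] (P11 ((n : ℤ) - 2) b)) := by
      intro b hb
      have hb := mem_range.1 hb
      have := hEven (n - 1) b (by omega) x y
      rw [Nat.cast_sub (by omega), Nat.cast_one, Nat.mul_sub, sub_sub] at this
      exact congrArg _ this
    rw [show 2 * n + 2 = 2 * (n + 1) by ring, h2, hEven n i hi,
      sum_congr rfl fun b hb => by rw [hEven n b (mem_range.1 hb)], sum_congr rfl hlow] at h
    simp only [mul_add, sum_add_distrib, mul_left_comm _ (x * y), ← mul_sum] at h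
    rw [eval_defect, eval_defect]
    linear_combination h
  have hO : ∀ i < 2 * n + 2,
      defect k (2 * n + 2) (2 * n) (midCoeff Γ (2 * n + 1) k i) (lowCoeff Γ (2 * n + 1) k i)
        (P10 n i) (P10 (n + 1) (i + 2 * (k - 1))) (P10 n) (P10 (n - 1)) = 0 ∧
      defect k (2 * n + 2) (2 * n) (midCoeff Γ (2 * n + 1) k i) (lowCoeff Γ (2 * n + 1) k i)
        (P01 n i) (P01 (n + 1) (i + 2 * (k - 1))) (P01 n) (P01 (n - 1)) = 0 := by
    intro i hi
    apply eq_zero_of_mul_eval_sq_add_mul_eval_sq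
    intro x y
    have h := hsq (2 * n + 1) i hi x y
    have h2 := hOdd (n + 1) (i + 2 * (k - 1)) (by omega) x y
    push_cast at h2
    have hlow : ∀ b ∈ range (2 * n), lowCoeff Γ (2 * n + 1) k i b *
        eval ![x, y] (S (2 * n + 1 - 2) b) = lowCoeff Γ (2 * n + 1) k i b *
          (x * eval ![x ^ 2, y ^ 2] (P10 ((n : ℤ) - 1) b) +
            y * eval ![x ^ 2, y ^ 2] (P01 ((n : ℤ) - 1) b)) := by
      intro b hb
      have hb := mem_range.1 hb
      have := hOdd (n - 1) b (by omega) x y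
      rw [Nat.cast_sub (by omega), Nat.cast_one,
        show 2 * (n - 1) + 1 = 2 * n + 1 - 2 by omega] at this
      exact congrArg _ this
    rw [show 2 * n + 1 + 2 = 2 * (n + 1) + 1 by ring, h2, hOdd n i hi,
      sum_congr rfl fun b hb => by rw [hOdd n b (mem_range.1 hb)], Nat.add_sub_cancel,
      sum_congr rfl hlow] at h
    simp only [mul_add, sum_add_distrib, mul_left_comm _ x, mul_left_comm _ y, ← mul_sum] at h
    rw [eval_defect, eval_defect]
    linear_combination h
  have hz0 : ∀ (m : ℤ) (b : ℕ), b % 2 ≠ 0 → P00 m b = 0 ∧ P10 m b = 0 := fun m b hb =>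
    (hzero m b).1 (Nat.odd_iff.2 (by omega))
  have hz1 : ∀ (m : ℤ) (b : ℕ), b % 2 ≠ 1 → P11 m b = 0 ∧ P01 m b = 0 := fun m b hb =>
    (hzero m b).2 (Nat.even_iff.2 (by omega))
  refine ⟨fun i hi => ?_, fun i hi => ?_, fun i hi => ?_, fun i hi => ?_⟩
  · exact three_term_compress (by omega) (by omega) hi (by omega)
      (fun b hb => (hz0 _ b hb).1) (fun b hb => (hz0 _ b hb).1) (hE (2 * i) (by omega)).1 u v
  · exact three_term_compress (by omega) (by omega) hi (by omega)
      (fun b hb => (hz1 _ b hb).1) (fun b hb => (hz1 _ b hb).1) (hE (2 * i + 1) (by omega)).2 u v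
  · exact three_term_compress (by omega) (by omega) hi (by omega)
      (fun b hb => (hz0 _ b hb).2) (fun b hb => (hz0 _ b hb).2) (hO (2 * i) (by omega)).1 u v
  · exact three_term_compress (by omega) (by omega) hi (by omega)
      (fun b hb => (hz1 _ b hb).2) (fun b hb => (hz1 _ b hb).2) (hO (2 * i + 1) (by omega)).2 u v
end
end
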